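/- Let x₀ ∈ ℝ^{n+1}, r > 0, and let F : B_{3r}(x₀) × ℝ × ℝ^{n+1} → ℝ^{n+1} and F₀ : B_{3r}(x₀) × ℝ × ℝ^{n+1} → ℝ be of class C¹ satisfying: for every M > 0 there exists λ(M) > 0 with ⟨D_pF(x,z,p)ξ, ξ⟩ ≥ λ(M)|ξ|² for all x ∈ B_{3r}(x₀), |z| ≤ M, |p| ≤ M, ξ ∈ ℝ^{n+1}. Let v, w be Lipschitz functions on B_{3r}(x₀) such that v is a weak subsolution and w a weak supersolution of div F(x, u, ∇u) = F₀(x, u, ∇u) in B_{3r}(x₀), i.e., ∫_{B_{3r}(x₀)} (⟨F(x, v, ∇v), ∇φ⟩ + F₀(x, v, ∇v)·φ) dx ≤ 0 and ∫_{B_{3r}(x₀)} (⟨F(x, w, ∇w), ∇φ⟩ + F₀(x, w, ∇w)·φ) dx ≥ 0 for every nonnegative φ ∈ C_c^∞(B_{3r}(x₀)). If v ≤ w in B_{3r}(x₀) and v(x₀) = w(x₀), then v ≡ w in B_r(x₀). -/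

import Mathlib

open MeasureTheory Metric Filter
open scoped InnerProductSpace NNReal ENNReal Topology

noncomputable section

/-- Euclidean space `ℝ^{n+1}`. -/
abbrev Eucl (n : ℕ) : Type := EuclideanSpace ℝ (Fin (n + 1))

namespace TOP

variable {n : ℕ}

/-- The `(n+1)`-st standard basis vector `e_{n+1}`. -/
def eLast (n : ℕ) : Eucl n := EuclideanSpace.single (Fin.last n) 1

/-- Open upper half ball `B_r⁺(x₀)`. -/
def hBall (x₀ : Eucl n) (r : ℝ) : Set (Eucl n) :=
  Metric.ball x₀ r ∩ {x : Eucl n | 0 < x (Fin.last n)}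

/-- Open lower half ball `B_r⁻(x₀)`. -/
def hBallNeg (x₀ : Eucl n) (r : ℝ) : Set (Eucl n) :=
  Metric.ball x₀ r ∩ {x : Eucl n | x (Fin.last n) < 0}

/-- Thin ball `B_r'(x₀)`. -/
def tBall (x₀ : Eucl n) (r : ℝ) : Set (Eucl n) :=
  Metric.ball x₀ r ∩ {x : Eucl n | x (Fin.last n) = 0}

/-- (H0): `F` and `F₀` are of class `C¹` on `B₁ × ℝ × ℝ^{n+1}`. -/
def H0 (F : Eucl n → ℝ → Eucl n → Eucl n) (F₀ : Eucl n → ℝ → Eucl n → ℝ) : Prop :=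
  ContDiffOn ℝ 1 (fun q : Eucl n × ℝ × Eucl n => F q.1 q.2.1 q.2.2)
      (Metric.ball (0 : Eucl n) 1 ×ˢ (Set.univ : Set ℝ) ×ˢ (Set.univ : Set (Eucl n))) ∧
    ContDiffOn ℝ 1 (fun q : Eucl n × ℝ × Eucl n => F₀ q.1 q.2.1 q.2.2)
      (Metric.ball (0 : Eucl n) 1 ×ˢ (Set.univ : Set ℝ) ×ˢ (Set.univ : Set (Eucl n)))

/-- (H1): uniform ellipticity of `D_pF` on compact subsets. -/
def H1 (F : Eucl n → ℝ → Eucl n → Eucl n) : Prop :=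
  ∀ M : ℝ, 0 < M → ∃ lam : ℝ, 0 < lam ∧
    ∀ x ∈ Metric.ball (0 : Eucl n) 1, ∀ z : ℝ, |z| ≤ M → ∀ p : Eucl n, ‖p‖ ≤ M →
      ∀ ξ : Eucl n, lam * ‖ξ‖ ^ 2 ≤ ⟪fderiv ℝ (F x z) p ξ, ξ⟫_ℝ

/-- (H1) with a prescribed ellipticity function `lam : M ↦ λ(M)`. -/
def H1With (lam : ℝ → ℝ) (F : Eucl n → ℝ → Eucl n → Eucl n) : Prop :=
  ∀ M : ℝ, 0 < M → 0 < lam M ∧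
    ∀ x ∈ Metric.ball (0 : Eucl n) 1, ∀ z : ℝ, |z| ≤ M → ∀ p : Eucl n, ‖p‖ ≤ M →
      ∀ ξ : Eucl n, lam M * ‖ξ‖ ^ 2 ≤ ⟪fderiv ℝ (F x z) p ξ, ξ⟫_ℝ

/-- `div_x F (x, z, p) = ∑ᵢ ∂_{xᵢ} Fᵢ (x, z, p)`. -/
def divx (F : Eucl n → ℝ → Eucl n → Eucl n) (x : Eucl n) (z : ℝ) (p : Eucl n) : ℝ :=
  ∑ i : Fin (n + 1), fderiv ℝ (fun y : Eucl n => F y z p i) x (EuclideanSpace.single i 1)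

/-- `(F, F₀)` is `t`-rescaled with bound function `L : M ↦ L(M)`. -/
def Rescaled (t : ℝ) (L : ℝ → ℝ) (F : Eucl n → ℝ → Eucl n → Eucl n)
    (F₀ : Eucl n → ℝ → Eucl n → ℝ) : Prop :=
  ∀ M : ℝ, 0 < M → ∀ x ∈ Metric.ball (0 : Eucl n) 1, ∀ z : ℝ, |z| ≤ M →
    ∀ p : Eucl n, ‖p‖ ≤ M →
      |(- divx F x z p - ⟪deriv (fun s : ℝ => F x s p) z, p⟫_ℝ + F₀ x z p)| ≤ t * L M ∧
        ‖fderiv ℝ (F x z) p‖ ≤ L M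

/-- The operator `H_t` acting classically on a `C²` function `φ`:
`H_t(φ)(x) = −div_x F − ⟨∂_z F, ∇φ⟩ − tr(D_pF · D²φ) + F₀`, all evaluated at
`(x, φ(x), ∇φ(x))`. -/
def Hop (F : Eucl n → ℝ → Eucl n → Eucl n) (F₀ : Eucl n → ℝ → Eucl n → ℝ)
    (φ : Eucl n → ℝ) (x : Eucl n) : ℝ :=
  - divx F x (φ x) (gradient φ x)
    - ⟪deriv (fun s : ℝ => F x s (gradient φ x)) (φ x), gradient φ x⟫_ℝ
    - ∑ i : Fin (n + 1),
        ⟪fderiv ℝ (F x (φ x)) (gradient φ x)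
          (fderiv ℝ (gradient φ) x (EuclideanSpace.single i 1)), EuclideanSpace.single i 1⟫_ℝ
    + F₀ x (φ x) (gradient φ x)

/-- The admissible class `A_g` for the thin obstacle problem: `W^{1,∞}(B₁)` functions
with boundary value `g` on `∂B₁` which are nonnegative on `B₁'`. -/
def AdmissibleThin (g v : Eucl n → ℝ) : Prop :=
  (∃ C : ℝ≥0, LipschitzOnWith C v (Metric.closedBall (0 : Eucl n) 1)) ∧
    (∀ x ∈ Metric.sphere (0 : Eucl n) 1, v x = g x) ∧
    ∀ x ∈ tBall (0 : Eucl n) 1, 0 ≤ v x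

/-- A (Lipschitz) solution of the thin obstacle problem in `B₁`. -/
def ThinSolution (F : Eucl n → ℝ → Eucl n → Eucl n) (F₀ : Eucl n → ℝ → Eucl n → ℝ)
    (g u : Eucl n → ℝ) : Prop :=
  AdmissibleThin g u ∧
    ∀ v : Eucl n → ℝ, AdmissibleThin g v →
      0 ≤ ∫ x in Metric.ball (0 : Eucl n) 1,
        (⟪F x (u x) (gradient u x), gradient v x - gradient u x⟫_ℝ +
          F₀ x (u x) (gradient u x) * (v x - u x))

/-- The admissible class `A_g` for the boundary (Signorini) obstacle problem:
`W^{1,∞}(B₁⁺)` functions with boundary value `g` on `∂B₁⁺ ∖ B₁'` which are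
nonnegative on `B₁'`. -/
def AdmissibleBdry (g v : Eucl n → ℝ) : Prop :=
  (∃ C : ℝ≥0, LipschitzOnWith C v
      (Metric.closedBall (0 : Eucl n) 1 ∩ {x : Eucl n | 0 ≤ x (Fin.last n)})) ∧
    (∀ x : Eucl n, ‖x‖ = 1 → 0 ≤ x (Fin.last n) → v x = g x) ∧
    ∀ x ∈ tBall (0 : Eucl n) 1, 0 ≤ v x

/-- A (Lipschitz) solution of the boundary (Signorini) obstacle problem in `B₁⁺`. -/
def BdrySolution (F : Eucl n → ℝ → Eucl n → Eucl n) (F₀ : Eucl n → ℝ → Eucl n → ℝ)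
    (g u : Eucl n → ℝ) : Prop :=
  AdmissibleBdry g u ∧
    ∀ v : Eucl n → ℝ, AdmissibleBdry g v →
      0 ≤ ∫ x in hBall (0 : Eucl n) 1,
        (⟪F x (u x) (gradient u x), gradient v x - gradient u x⟫_ℝ +
          F₀ x (u x) (gradient u x) * (v x - u x))

/-- The coincidence set `Λ(u) = {x ∈ B₁' : u(x) = 0}`. -/
def coincidenceSet (u : Eucl n → ℝ) : Set (Eucl n) :=
  {x ∈ tBall (0 : Eucl n) 1 | u x = 0}

/-- The free boundary `Γ(u)`: the boundary of `Λ(u)` in the relative topology of `B₁'`. -/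
def freeBoundary (u : Eucl n → ℝ) : Set (Eucl n) :=
  {x ∈ coincidenceSet u |
    ∀ r : ℝ, 0 < r → ∃ y ∈ tBall (0 : Eucl n) 1, y ∈ Metric.ball x r ∧ 0 < u y}

/-- `w` satisfies the Caccioppoli inequality with constant `Q` at `x₀ ∈ B₁'`. -/
def CaccAt (w : Eucl n → ℝ) (Q : ℝ) (x₀ : Eucl n) : Prop :=
  ∀ k : ℝ, 0 ≤ k → ∀ r R : ℝ, 0 < r → r < R → R < 1 - ‖x₀‖ →
    (∫ x in ({x : Eucl n | k ≤ w x} ∩ hBall x₀ r), ‖gradient w x‖ ^ 2) ≤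
      Q / (R - r) ^ 2 * (∫ x in ({x : Eucl n | k ≤ w x} ∩ hBall x₀ R), (w x - k) ^ 2) +
        Q * (volume ({x : Eucl n | k ≤ w x} ∩ hBall x₀ R)).toReal

/-- Difference quotient `D_e^h w (x) = (w(x + h e) − w(x))/h`. -/
def diffQuot (h : ℝ) (e : Eucl n) (w : Eucl n → ℝ) (x : Eucl n) : ℝ :=
  (w (x + h • e) - w x) / h

/-- The barrier function `η(x) = t(|x' − x₀'|² − K x_{n+1}²) + m x_{n+1} + γ`. -/
def etaFn (x₀ : Eucl n) (t K m γ : ℝ) (x : Eucl n) : ℝ :=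
  t * ((∑ i : Fin n, (x i.castSucc - x₀ i.castSucc) ^ 2) - K * (x (Fin.last n)) ^ 2) +
    m * x (Fin.last n) + γ

end TOP

section Smoothing

variable {E : Type*} [NormedAddCommGroup E] [NormedSpace ℝ E] [FiniteDimensional ℝ E]
  [MeasurableSpace E] [BorelSpace E] (μ : Measure E) [μ.IsAddHaarMeasure]

open scoped Convolution in
theorem ContDiffBump.hasFDerivAt_normed_convolution (ρ : ContDiffBump (0 : E)) {C : ℝ≥0} {f : E → ℝ}
    (hf : LipschitzWith C f) (x : E) :
    HasFDerivAt (ρ.normed μ ⋆[ContinuousLinearMap.lsmul ℝ ℝ, μ] f)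
      ((ρ.normed μ ⋆[ContinuousLinearMap.lsmul ℝ ℝ, μ] fderiv ℝ f) x) x := by
  have hmeas : ∀ y, Continuous fun t => ρ.normed μ t • f (y - t) := fun y =>
    ρ.continuous_normed.smul (hf.continuous.comp (by fun_prop))
  have hsupp : ∀ y, HasCompactSupport fun t => ρ.normed μ t • f (y - t) := fun y =>
    ρ.hasCompactSupport_normed.smul_right
  have hmf : Measurable (fderiv ℝ f) := measurable_fderiv ℝ f
  refine (hasFDerivAt_integral_of_dominated_loc_of_lip' (μ := μ) (s := Set.univ)
    (F := fun y t => ρ.normed μ t • f (y - t)) (x₀ := x)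
    (F' := fun t => ρ.normed μ t • fderiv ℝ f (x - t)) (bound := fun t => ρ.normed μ t * C)
    univ_mem (fun y _ => (hmeas y).aestronglyMeasurable)
    ((hmeas x).integrable_of_hasCompactSupport (hsupp x)) ?_ ?_ ?_ ?_).2
  · exact (ρ.continuous_normed.measurable.smul
      (hmf.comp (measurable_const.sub measurable_id))).aestronglyMeasurable
  · refine Eventually.of_forall fun t y _ => ?_
    rw [← smul_sub, norm_smul, Real.norm_of_nonneg (ρ.nonneg_normed t), mul_assoc]
    refine mul_le_mul_of_nonneg_left ?_ (ρ.nonneg_normed t)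
    simpa using hf.norm_sub_le (y - t) (x - t)
  · exact ρ.integrable_normed.mul_const _
  · have h := (Measure.measurePreserving_sub_left μ x).quasiMeasurePreserving.ae
      (hf.ae_differentiableAt (μ := μ))
    filter_upwards [h] with t ht
    have h1 := ht.hasFDerivAt.comp x ((hasFDerivAt_id x).sub_const t)
    exact h1.const_smul (ρ.normed μ t)

open scoped Convolution in
theorem LipschitzWith.exists_smooth_approx {C : ℝ≥0} {f : E → ℝ} (hf : LipschitzWith C f) :
    ∃ g : ℕ → E → ℝ, (∀ k, ContDiff ℝ (⊤ : ℕ∞) (g k)) ∧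
      (∀ k, ∀ x, ‖fderiv ℝ (g k) x‖ ≤ C) ∧
      (∀ k x a, (∀ y, a ≤ f y) → a ≤ g k x) ∧
      (∀ k x b, (∀ y, f y ≤ b) → g k x ≤ b) ∧
      (∀ k, tsupport (g k) ⊆ cthickening (1 / ((k : ℝ) + 1)) (tsupport f)) ∧
      (∀ x, Tendsto (fun k => g k x) atTop (𝓝 (f x))) ∧
      (∀ᵐ x ∂μ, Tendsto (fun k => fderiv ℝ (g k) x) atTop (𝓝 (fderiv ℝ f x))) := by
  let ρ : ℕ → ContDiffBump (0 : E) := fun k =>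
    { rIn := 1 / ((k : ℝ) + 1) / 2
      rOut := 1 / ((k : ℝ) + 1)
      rIn_pos := by positivity
      rIn_lt_rOut := half_lt_self (by positivity) }
  have hρ : Tendsto (fun k => (ρ k).rOut) atTop (𝓝 0) := tendsto_one_div_add_atTop_nhds_zero_nat
  have hint : ∀ k x, Integrable (fun t => (ρ k).normed μ t * f (x - t)) μ := fun k x =>
    ((ρ k).continuous_normed.mul (hf.continuous.comp (by fun_prop))).integrable_of_hasCompactSupport
      ((ρ k).hasCompactSupport_normed.mul_right)
  have hconst : ∀ k (a : ℝ), ∫ t, (ρ k).normed μ t * a ∂μ = a := fun k a => by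
    rw [integral_mul_const, (ρ k).integral_normed, one_mul]
  refine ⟨fun k => (ρ k).normed μ ⋆[ContinuousLinearMap.lsmul ℝ ℝ, μ] f, fun k => ?_, fun k x => ?_,
    fun k x a ha => ?_, fun k x b hb => ?_, fun k => ?_, fun x => ?_, ?_⟩
  · exact (ρ k).hasCompactSupport_normed.contDiff_convolution_left _ (ρ k).contDiff_normed
      hf.continuous.locallyIntegrable
  · rw [((ρ k).hasFDerivAt_normed_convolution μ hf x).fderiv]
    refine (norm_integral_le_of_norm_le ((ρ k).integrable_normed.mul_const (C : ℝ))
      (Eventually.of_forall fun t => ?_)).trans (hconst k C).le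
    rw [ContinuousLinearMap.lsmul_apply, norm_smul, Real.norm_of_nonneg ((ρ k).nonneg_normed t)]
    exact mul_le_mul_of_nonneg_left (norm_fderiv_le_of_lipschitz ℝ hf) ((ρ k).nonneg_normed t)
  · rw [← hconst k a]
    exact integral_mono ((ρ k).integrable_normed.mul_const _) (hint k x) fun t =>
      mul_le_mul_of_nonneg_left (ha _) ((ρ k).nonneg_normed t)
  · rw [← hconst k b]
    exact integral_mono (hint k x) ((ρ k).integrable_normed.mul_const _) fun t =>
      mul_le_mul_of_nonneg_left (hb _) ((ρ k).nonneg_normed t)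
  · refine closure_minimal ((support_convolution_subset_swap _).trans ?_) isClosed_cthickening
    rintro _ ⟨y, hy, t, ht, rfl⟩
    rw [(ρ k).support_normed_eq, mem_ball_zero_iff] at ht
    refine mem_cthickening_of_dist_le _ y _ _ (subset_tsupport _ hy) ?_
    simpa [ρ] using ht.le
  · exact ContDiffBump.convolution_tendsto_right_of_continuous hρ hf.continuous x
  · have hloc : LocallyIntegrable (fderiv ℝ f) μ := by
      refine (locallyIntegrable_const (C : ℝ)).mono
        (measurable_fderiv ℝ f).aestronglyMeasurable (Eventually.of_forall fun x => ?_)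
      simpa using norm_fderiv_le_of_lipschitz ℝ hf
    filter_upwards [ContDiffBump.ae_convolution_tendsto_right_of_locallyIntegrable (K := 2) hρ
      (Eventually.of_forall fun k => (mul_div_cancel₀ _ two_ne_zero).ge) hloc] with x hx
    exact hx.congr fun k => ((ρ k).hasFDerivAt_normed_convolution μ hf x).fderiv.symm

end Smoothing

section Sobolev

variable {E : Type*} [NormedAddCommGroup E] [NormedSpace ℝ E] [FiniteDimensional ℝ E]
  [MeasurableSpace E] [BorelSpace E] (μ : Measure E) [μ.IsAddHaarMeasure]

theorem exists_lintegral_rpow_le_of_contDiff [Nontrivial E] :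
    ∃ κ : ℝ, 1 < κ ∧ ∃ C : ℝ≥0, ∀ g : E → ℝ, ContDiff ℝ 1 g → HasCompactSupport g →
      ∫⁻ x, ‖g x‖ₑ ^ κ ∂μ ≤
        C * ((∫⁻ x, ‖fderiv ℝ g x‖ₑ ∂μ) + ∫⁻ x, ‖g x‖ₑ ∂μ) ^ κ := by
  have hN : 0 < Module.finrank ℝ E := Module.finrank_pos
  have hN1 : (1 : ℝ) < Module.finrank ℝ (E × ℝ) := by
    rw [Module.finrank_prod, Module.finrank_self]
    exact_mod_cast Nat.lt_add_of_pos_left hN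
  have hκ := Real.HolderConjugate.conjExponent hN1
  set κ := Real.conjExponent (Module.finrank ℝ (E × ℝ)) with hκdef
  have hκ1 : 1 < κ := hκ.symm.lt
  let ζ : ContDiffBump (0 : ℝ) := ⟨1, 2, one_pos, one_lt_two⟩
  have hζ1 : (∫⁻ t, ‖ζ t‖ₑ) < ∞ :=
    (ζ.continuous.integrable_of_hasCompactSupport ζ.hasCompactSupport).hasFiniteIntegral
  have hζ' : Continuous (fderiv ℝ ζ) := (ζ.contDiff (n := 1)).continuous_fderiv one_ne_zero
  have hζ2 : (∫⁻ t, ‖fderiv ℝ ζ t‖ₑ) < ∞ :=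
    (hζ'.integrable_of_hasCompactSupport (ζ.hasCompactSupport.fderiv ℝ)).hasFiniteIntegral
  have hζ3 : 1 ≤ ∫⁻ t, ‖ζ t‖ₑ ^ κ := by
    calc (1 : ℝ≥0∞) ≤ volume (closedBall (0 : ℝ) 1) := by
          rw [Real.volume_closedBall]; norm_num
      _ = ∫⁻ t in closedBall (0 : ℝ) 1, 1 := by simp
      _ = ∫⁻ t in closedBall (0 : ℝ) 1, ‖ζ t‖ₑ ^ κ := by
          refine setLIntegral_congr_fun measurableSet_closedBall fun t ht => ?_
          simp [ζ.one_of_mem_closedBall ht]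
      _ ≤ _ := setLIntegral_le_lintegral _ _
  set B : ℝ≥0∞ := (∫⁻ t, ‖ζ t‖ₑ) + ∫⁻ t, ‖fderiv ℝ ζ t‖ₑ with hB
  have hBfin : B ≠ ∞ := (ENNReal.add_lt_top.2 ⟨hζ1, hζ2⟩).ne
  set S := lintegralPowLePowLIntegralFDerivConst (μ.prod (volume : Measure ℝ)) κ
  refine ⟨κ, hκ1, S * B.toNNReal ^ κ, fun g hg hgc => ?_⟩
  have hg' : Continuous (fderiv ℝ g) := hg.continuous_fderiv one_ne_zero
  let G : E × ℝ → ℝ := fun z => g z.1 * ζ z.2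
  have hG : ContDiff ℝ 1 G := (hg.comp contDiff_fst).mul (ζ.contDiff.comp contDiff_snd)
  have hGc : HasCompactSupport G := by
    refine HasCompactSupport.intro (hgc.isCompact.prod ζ.hasCompactSupport.isCompact) ?_
    rintro ⟨x, t⟩ hz
    by_cases hx : x ∈ tsupport g
    · have ht : t ∉ tsupport ζ := fun ht => hz ⟨hx, ht⟩
      simp [G, image_eq_zero_of_notMem_tsupport ht]
    · simp [G, image_eq_zero_of_notMem_tsupport hx]
  have hsob := lintegral_pow_le_pow_lintegral_fderiv (μ.prod (volume : Measure ℝ)) hG hGc hκ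
  have hleft : ∫⁻ z, ‖G z‖ₑ ^ κ ∂(μ.prod volume) =
      (∫⁻ x, ‖g x‖ₑ ^ κ ∂μ) * ∫⁻ t, ‖ζ t‖ₑ ^ κ := by
    rw [← lintegral_prod_mul]
    · refine lintegral_congr fun z => ?_
      simp only [G, enorm_mul]
      rw [ENNReal.mul_rpow_of_nonneg _ _ (by linarith)]
    · exact (hg.continuous.enorm.measurable.pow_const _).aemeasurable
    · exact (ζ.continuous.enorm.measurable.pow_const _).aemeasurable
  have hderiv : ∀ z, ‖fderiv ℝ G z‖ₑ ≤
      ‖g z.1‖ₑ * ‖fderiv ℝ ζ z.2‖ₑ + ‖fderiv ℝ g z.1‖ₑ * ‖ζ z.2‖ₑ := by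
    intro z
    have h1 : HasFDerivAt (fun z : E × ℝ => g z.1)
        ((fderiv ℝ g z.1).comp (ContinuousLinearMap.fst ℝ E ℝ)) z :=
      ((hg.differentiable one_ne_zero) z.1).hasFDerivAt.comp z hasFDerivAt_fst
    have h2 : HasFDerivAt (fun z : E × ℝ => ζ z.2)
        ((fderiv ℝ ζ z.2).comp (ContinuousLinearMap.snd ℝ E ℝ)) z :=
      (((ζ.contDiff (n := 1)).differentiable one_ne_zero) z.2).hasFDerivAt.comp z hasFDerivAt_snd
    have hf : ‖(fderiv ℝ g z.1).comp (ContinuousLinearMap.fst ℝ E ℝ)‖ ≤ ‖fderiv ℝ g z.1‖ :=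
      (ContinuousLinearMap.opNorm_comp_le _ _).trans
        (mul_le_of_le_one_right (norm_nonneg _) (ContinuousLinearMap.norm_fst_le ℝ E ℝ))
    have hs : ‖(fderiv ℝ ζ z.2).comp (ContinuousLinearMap.snd ℝ E ℝ)‖ ≤ ‖fderiv ℝ ζ z.2‖ :=
      (ContinuousLinearMap.opNorm_comp_le _ _).trans
        (mul_le_of_le_one_right (norm_nonneg _) (ContinuousLinearMap.norm_snd_le ℝ E ℝ))
    rw [show fderiv ℝ G z = _ from (h1.mul h2).fderiv]
    refine (enorm_add_le (g z.1 • (fderiv ℝ ζ z.2).comp (ContinuousLinearMap.snd ℝ E ℝ))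
      (ζ z.2 • (fderiv ℝ g z.1).comp (ContinuousLinearMap.fst ℝ E ℝ))).trans ?_
    rw [enorm_smul, enorm_smul, mul_comm ‖fderiv ℝ g z.1‖ₑ]
    gcongr
    · exact enorm_le_iff_norm_le.2 hs
    · exact enorm_le_iff_norm_le.2 hf
  have hright : ∫⁻ z, ‖fderiv ℝ G z‖ₑ ∂(μ.prod volume) ≤
      B * ((∫⁻ x, ‖fderiv ℝ g x‖ₑ ∂μ) + ∫⁻ x, ‖g x‖ₑ ∂μ) := by
    calc ∫⁻ z, ‖fderiv ℝ G z‖ₑ ∂(μ.prod volume)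
        ≤ ∫⁻ z, ‖g z.1‖ₑ * ‖fderiv ℝ ζ z.2‖ₑ + ‖fderiv ℝ g z.1‖ₑ * ‖ζ z.2‖ₑ
          ∂(μ.prod volume) := lintegral_mono hderiv
      _ = (∫⁻ x, ‖g x‖ₑ ∂μ) * (∫⁻ t, ‖fderiv ℝ ζ t‖ₑ) +
          (∫⁻ x, ‖fderiv ℝ g x‖ₑ ∂μ) * ∫⁻ t, ‖ζ t‖ₑ := by
        have hm : Measurable fun z : E × ℝ => ‖g z.1‖ₑ * ‖fderiv ℝ ζ z.2‖ₑ :=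
          ((hg.continuous.comp continuous_fst).enorm.measurable).mul
            ((hζ'.comp continuous_snd).enorm.measurable)
        rw [lintegral_add_left hm,
          lintegral_prod_mul (f := fun x => ‖g x‖ₑ) (g := fun t => ‖fderiv ℝ ζ t‖ₑ)
            hg.continuous.enorm.measurable.aemeasurable hζ'.enorm.measurable.aemeasurable,
          lintegral_prod_mul (f := fun x => ‖fderiv ℝ g x‖ₑ) (g := fun t => ‖ζ t‖ₑ)
            hg'.enorm.measurable.aemeasurable ζ.continuous.enorm.measurable.aemeasurable]
      _ ≤ (∫⁻ x, ‖g x‖ₑ ∂μ) * B + (∫⁻ x, ‖fderiv ℝ g x‖ₑ ∂μ) * B := by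
        gcongr
        · exact le_add_self
        · exact le_self_add
      _ = _ := by ring
  calc ∫⁻ x, ‖g x‖ₑ ^ κ ∂μ ≤ (∫⁻ x, ‖g x‖ₑ ^ κ ∂μ) * ∫⁻ t, ‖ζ t‖ₑ ^ κ :=
        le_mul_of_one_le_right zero_le hζ3
    _ ≤ S * (∫⁻ z, ‖fderiv ℝ G z‖ₑ ∂(μ.prod volume)) ^ κ := hleft ▸ hsob
    _ ≤ S * (B * ((∫⁻ x, ‖fderiv ℝ g x‖ₑ ∂μ) + ∫⁻ x, ‖g x‖ₑ ∂μ)) ^ κ := by gcongr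
    _ = _ := by
      rw [ENNReal.mul_rpow_of_nonneg _ _ (by linarith), ENNReal.coe_mul,
        ENNReal.coe_rpow_of_nonneg _ (by linarith : 0 ≤ κ), ENNReal.coe_toNNReal hBfin, mul_assoc]

theorem exists_lintegral_rpow_le_of_lipschitz [Nontrivial E] :
    ∃ κ : ℝ, 1 < κ ∧ ∃ C : ℝ≥0, ∀ (g : E → ℝ) (L : ℝ≥0), LipschitzWith L g →
      HasCompactSupport g →
      ∫⁻ x, ‖g x‖ₑ ^ κ ∂μ ≤
        C * ((∫⁻ x, ‖fderiv ℝ g x‖ₑ ∂μ) + ∫⁻ x, ‖g x‖ₑ ∂μ) ^ κ := by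
  obtain ⟨κ, hκ, C, hC⟩ := exists_lintegral_rpow_le_of_contDiff μ
  refine ⟨κ, hκ, C, fun g L hg hgc => ?_⟩
  obtain ⟨G, hGs, hGd, hGlo, hGhi, hGsupp, hGt, hGdt⟩ := hg.exists_smooth_approx μ
  obtain ⟨M, hM⟩ : ∃ M, ∀ x, ‖g x‖ ≤ M := hgc.exists_bound_of_continuous hg.continuous
  set K := cthickening 1 (tsupport g) with hK
  have hKc : IsCompact K := hgc.isCompact.cthickening
  have hGK : ∀ k, tsupport (G k) ⊆ K := fun k => (hGsupp k).trans <|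
    cthickening_mono (by rw [div_le_one (by positivity)]; linarith [k.cast_nonneg (α := ℝ)]) _
  have hGc : ∀ k, HasCompactSupport (G k) := fun k => hKc.of_isClosed_subset
    (isClosed_tsupport _) (hGK k)
  have hfin : ∀ a : ℝ≥0∞, a ≠ ∞ → ∫⁻ x, K.indicator (fun _ => a) x ∂μ ≠ ∞ := fun a ha => by
    rw [lintegral_indicator_const hKc.measurableSet]
    exact ENNReal.mul_ne_top ha hKc.measure_lt_top.ne
  have h1 : Tendsto (fun k => ∫⁻ x, ‖fderiv ℝ (G k) x‖ₑ ∂μ) atTop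
      (𝓝 (∫⁻ x, ‖fderiv ℝ g x‖ₑ ∂μ)) := by
    refine tendsto_lintegral_of_dominated_convergence (K.indicator fun _ => (L : ℝ≥0∞))
      (fun k => (measurable_fderiv ℝ (G k)).enorm) (fun k => Eventually.of_forall fun x => ?_)
      (hfin _ ENNReal.coe_ne_top) ?_
    · by_cases hx : x ∈ K
      · rw [Set.indicator_of_mem hx]
        exact enorm_le_coe.2 (hGd k x)
      · have : x ∉ tsupport (fderiv ℝ (G k)) :=
          fun h => hx (hGK k (tsupport_fderiv_subset ℝ h))
        simp only [image_eq_zero_of_notMem_tsupport this]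
        exact (enorm_zero (E := E →L[ℝ] ℝ)).trans_le zero_le
    · filter_upwards [hGdt] with x hx using hx.enorm
  have h2 : Tendsto (fun k => ∫⁻ x, ‖G k x‖ₑ ∂μ) atTop (𝓝 (∫⁻ x, ‖g x‖ₑ ∂μ)) := by
    refine tendsto_lintegral_of_dominated_convergence (K.indicator fun _ => ENNReal.ofReal M)
      (fun k => (hGs k).continuous.measurable.enorm) (fun k => Eventually.of_forall fun x => ?_)
      (hfin _ ENNReal.ofReal_ne_top) (Eventually.of_forall fun x => (hGt x).enorm)
    by_cases hx : x ∈ K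
    · rw [Set.indicator_of_mem hx]
      change ‖G k x‖ₑ ≤ _
      rw [← ofReal_norm]
      refine ENNReal.ofReal_le_ofReal (abs_le.2 ⟨?_, ?_⟩)
      · exact hGlo k x _ fun y => (abs_le.1 (hM y)).1
      · exact hGhi k x _ fun y => (abs_le.1 (hM y)).2
    · simp [image_eq_zero_of_notMem_tsupport fun h => hx (hGK k h)]
  calc ∫⁻ x, ‖g x‖ₑ ^ κ ∂μ = ∫⁻ x, liminf (fun k => ‖G k x‖ₑ ^ κ) atTop ∂μ := by
        refine lintegral_congr fun x => (Tendsto.liminf_eq ?_).symm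
        exact (ENNReal.continuous_rpow_const.tendsto _).comp (hGt x).enorm
    _ ≤ liminf (fun k => ∫⁻ x, ‖G k x‖ₑ ^ κ ∂μ) atTop :=
        lintegral_liminf_le fun k => (hGs k).continuous.measurable.enorm.pow_const _
    _ ≤ liminf (fun k => C * ((∫⁻ x, ‖fderiv ℝ (G k) x‖ₑ ∂μ) + ∫⁻ x, ‖G k x‖ₑ ∂μ) ^ κ) atTop :=
        liminf_le_liminf (Eventually.of_forall fun k =>
          hC (G k) ((hGs k).of_le (by exact_mod_cast le_top)) (hGc k))
    _ = _ := Tendsto.liminf_eq <| ENNReal.Tendsto.const_mul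
        ((ENNReal.continuous_rpow_const.tendsto _).comp (h1.add h2)) (Or.inr ENNReal.coe_ne_top)

end Sobolev

section Poincare

theorem sq_lintegral_le {α : Type*} [MeasurableSpace α] {ν : Measure α} {f : α → ℝ≥0∞}
    (hν : ν Set.univ ≤ 1) (hf : AEMeasurable f ν) :
    (∫⁻ t, f t ∂ν) ^ 2 ≤ ∫⁻ t, f t ^ 2 ∂ν := by
  have h := ENNReal.lintegral_mul_le_Lp_mul_Lq ν Real.HolderConjugate.two_two hf
    (aemeasurable_const (b := (1 : ℝ≥0∞)))
  simp only [Pi.mul_apply, mul_one, ENNReal.one_rpow, lintegral_const, one_mul] at h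
  calc (∫⁻ t, f t ∂ν) ^ 2 ≤ ((∫⁻ t, f t ^ (2 : ℝ) ∂ν) ^ (1 / 2 : ℝ) * 1) ^ 2 := by
        refine pow_le_pow_left' (h.trans ?_) 2
        gcongr
        exact ENNReal.rpow_le_one hν (by norm_num)
    _ = _ := by
        rw [mul_one, ← ENNReal.rpow_natCast, ← ENNReal.rpow_mul]
        simp

variable {E : Type*} [NormedAddCommGroup E] [NormedSpace ℝ E]

theorem enorm_sub_sq_le_lintegral_segment {f : E → ℝ} (hf : ContDiff ℝ 1 f) (x y : E) :
    ‖f x - f ((2⁻¹ : ℝ) • x + (2⁻¹ : ℝ) • y)‖ₑ ^ 2 ≤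
      ∫⁻ t in Set.Ioc (0 : ℝ) 2⁻¹,
        ‖fderiv ℝ f ((1 - t) • x + t • y)‖ₑ ^ 2 * ‖y - x‖ₑ ^ 2 := by
  set γ : ℝ → E := fun t => (1 - t) • x + t • y with hγ
  have hγd : ∀ t, HasDerivAt γ (y - x) t := fun t => by
    have h1 := (((hasDerivAt_id t).const_sub 1).smul_const x).add ((hasDerivAt_id t).smul_const y)
    have h2 : (-1 : ℝ) • x + (1 : ℝ) • y = y - x := by simp [sub_eq_neg_add]
    rw [h2] at h1
    exact h1
  have hγc : Continuous γ := by fun_prop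
  have hd : ∀ t, HasDerivAt (fun t => f (γ t)) (fderiv ℝ f (γ t) (y - x)) t := fun t =>
    ((hf.differentiable one_ne_zero) (γ t)).hasFDerivAt.comp_hasDerivAt t (hγd t)
  have hc : Continuous fun t => fderiv ℝ f (γ t) (y - x) :=
    ((hf.continuous_fderiv one_ne_zero).comp hγc).clm_apply continuous_const
  have hftc := intervalIntegral.integral_eq_sub_of_hasDerivAt (a := 0) (b := 2⁻¹)
    (fun t _ => hd t) (hc.intervalIntegrable _ _)
  have h0 : γ 0 = x := by simp [hγ]
  have h1 : γ 2⁻¹ = (2⁻¹ : ℝ) • x + (2⁻¹ : ℝ) • y := by simp only [hγ]; norm_num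
  rw [h0, h1, intervalIntegral.integral_of_le (by norm_num)] at hftc
  calc ‖f x - f ((2⁻¹ : ℝ) • x + (2⁻¹ : ℝ) • y)‖ₑ ^ 2
      = ‖∫ t in Set.Ioc (0 : ℝ) 2⁻¹, fderiv ℝ f (γ t) (y - x)‖ₑ ^ 2 := by
        rw [hftc, ← enorm_neg, neg_sub]
    _ ≤ (∫⁻ t in Set.Ioc (0 : ℝ) 2⁻¹, ‖fderiv ℝ f (γ t) (y - x)‖ₑ) ^ 2 := by
        gcongr
        exact enorm_integral_le_lintegral_enorm _
    _ ≤ ∫⁻ t in Set.Ioc (0 : ℝ) 2⁻¹, ‖fderiv ℝ f (γ t) (y - x)‖ₑ ^ 2 := by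
        refine sq_lintegral_le ?_ hc.enorm.measurable.aemeasurable
        rw [Measure.restrict_apply_univ, Real.volume_Ioc, ENNReal.ofReal_le_one]
        norm_num
    _ ≤ _ := by
        refine lintegral_mono fun t => ?_
        rw [← mul_pow]
        gcongr
        exact ContinuousLinearMap.le_opENorm _ _

variable [FiniteDimensional ℝ E]
  [MeasurableSpace E] [BorelSpace E] (μ : Measure E) [μ.IsAddHaarMeasure]

theorem lintegral_comp_smul_add {h : E → ℝ≥0∞} (hh : Measurable h) {r : ℝ} (hr : r ≠ 0) (c : E) :
    ∫⁻ x, h (r • x + c) ∂μ = ENNReal.ofReal |(r ^ Module.finrank ℝ E)⁻¹| * ∫⁻ x, h x ∂μ := by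
  have h1 : ∫⁻ x, h (r • x + c) ∂μ = ∫⁻ x, h (x + c) ∂(μ.map (r • ·)) :=
    (lintegral_map (hh.comp (measurable_add_const c)) (measurable_const_smul r)).symm
  rw [h1, Measure.map_addHaar_smul μ hr, lintegral_smul_measure, lintegral_add_right_eq_self,
    smul_eq_mul]

theorem lintegral_convexCombination_le {s : Set E} (hs : Convex ℝ s) (hsm : MeasurableSet s)
    {h : E → ℝ≥0∞} (hh : Measurable h) {y : E} (hy : y ∈ s) {t : ℝ} (ht : t ∈ Set.Ioc (0 : ℝ) 2⁻¹) :
    ∫⁻ x in s, h ((1 - t) • x + t • y) ∂μ ≤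
      ENNReal.ofReal (2 ^ Module.finrank ℝ E) * ∫⁻ x in s, h x ∂μ := by
  have ht1 : 0 < 1 - t := by linarith [ht.2]
  calc ∫⁻ x in s, h ((1 - t) • x + t • y) ∂μ
      = ∫⁻ x in s, s.indicator h ((1 - t) • x + t • y) ∂μ := by
        refine setLIntegral_congr_fun hsm fun x hx => ?_
        rw [Set.indicator_of_mem (hs hx hy ht1.le ht.1.le (by ring))]
    _ ≤ ∫⁻ x, s.indicator h ((1 - t) • x + t • y) ∂μ := setLIntegral_le_lintegral _ _
    _ = ENNReal.ofReal |((1 - t) ^ Module.finrank ℝ E)⁻¹| * ∫⁻ x in s, h x ∂μ := by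
        rw [lintegral_comp_smul_add μ (hh.indicator hsm) ht1.ne', lintegral_indicator hsm]
    _ ≤ _ := by
        gcongr
        rw [abs_of_pos (by positivity), ← inv_pow]
        gcongr
        rw [inv_le_comm₀ ht1 two_pos]
        linarith [ht.2]

theorem lintegral_sub_midpoint_sq_le_of_contDiff {s : Set E} (hs : Convex ℝ s)
    (hsm : MeasurableSet s) {D : ℝ≥0} (hD : ∀ x ∈ s, ∀ y ∈ s, ‖y - x‖ ≤ D)
    {f : E → ℝ} (hf : ContDiff ℝ 1 f) {y : E} (hy : y ∈ s) :
    ∫⁻ x in s, ‖f x - f ((2⁻¹ : ℝ) • x + (2⁻¹ : ℝ) • y)‖ₑ ^ 2 ∂μ ≤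
      ENNReal.ofReal (2 ^ Module.finrank ℝ E) * D ^ 2 * ∫⁻ x in s, ‖fderiv ℝ f x‖ₑ ^ 2 ∂μ := by
  have hf' : Continuous (fderiv ℝ f) := hf.continuous_fderiv one_ne_zero
  set h : E → ℝ≥0∞ := fun x => ‖fderiv ℝ f x‖ₑ ^ 2 with hh
  have hhm : Measurable h := hf'.enorm.measurable.pow_const 2
  have hcomb : Measurable fun p : E × ℝ => h ((1 - p.2) • p.1 + p.2 • y) :=
    hhm.comp (by fun_prop)
  calc ∫⁻ x in s, ‖f x - f ((2⁻¹ : ℝ) • x + (2⁻¹ : ℝ) • y)‖ₑ ^ 2 ∂μ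
      ≤ ∫⁻ x in s, (∫⁻ t in Set.Ioc (0 : ℝ) 2⁻¹, h ((1 - t) • x + t • y)) * D ^ 2 ∂μ := by
        refine setLIntegral_mono' hsm fun x hx => ?_
        have hm : Measurable fun t : ℝ => h ((1 - t) • x + t • y) := hhm.comp (by fun_prop)
        rw [← lintegral_mul_const _ hm]
        refine (enorm_sub_sq_le_lintegral_segment hf x y).trans (lintegral_mono fun t => ?_)
        gcongr
        exact enorm_le_coe.2 (hD x hx y hy)
    _ = (∫⁻ t in Set.Ioc (0 : ℝ) 2⁻¹, ∫⁻ x in s, h ((1 - t) • x + t • y) ∂μ) * D ^ 2 := by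
        rw [lintegral_mul_const _ (Measurable.lintegral_prod_right hcomb),
          lintegral_lintegral_swap hcomb.aemeasurable]
    _ ≤ (∫⁻ _ in Set.Ioc (0 : ℝ) 2⁻¹,
          ENNReal.ofReal (2 ^ Module.finrank ℝ E) * ∫⁻ x in s, h x ∂μ) * D ^ 2 := by
        gcongr ?_ * _
        exact setLIntegral_mono' measurableSet_Ioc fun t ht =>
          lintegral_convexCombination_le μ hs hsm hhm hy ht
    _ ≤ (ENNReal.ofReal (2 ^ Module.finrank ℝ E) * ∫⁻ x in s, h x ∂μ) * D ^ 2 := by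
        gcongr
        rw [setLIntegral_const]
        refine mul_le_of_le_one_right zero_le ?_
        rw [Real.volume_Ioc, ENNReal.ofReal_le_one]
        norm_num
    _ = _ := by ring

theorem LipschitzWith.lintegral_sub_midpoint_sq_le {s : Set E} (hs : Convex ℝ s)
    (hsm : MeasurableSet s) (hsf : μ s ≠ ∞) {D : ℝ≥0} (hD : ∀ x ∈ s, ∀ y ∈ s, ‖y - x‖ ≤ D)
    {f : E → ℝ} {L : ℝ≥0} (hf : LipschitzWith L f) {y : E} (hy : y ∈ s) :
    ∫⁻ x in s, ‖f x - f ((2⁻¹ : ℝ) • x + (2⁻¹ : ℝ) • y)‖ₑ ^ 2 ∂μ ≤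
      ENNReal.ofReal (2 ^ Module.finrank ℝ E) * D ^ 2 * ∫⁻ x in s, ‖fderiv ℝ f x‖ₑ ^ 2 ∂μ := by
  obtain ⟨G, hGs, hGd, -, -, -, hGt, hGdt⟩ := hf.exists_smooth_approx μ
  have h1 : Tendsto (fun k => ∫⁻ x in s, ‖fderiv ℝ (G k) x‖ₑ ^ 2 ∂μ) atTop
      (𝓝 (∫⁻ x in s, ‖fderiv ℝ f x‖ₑ ^ 2 ∂μ)) := by
    refine tendsto_lintegral_of_dominated_convergence (fun _ => (L : ℝ≥0∞) ^ 2)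
      (fun k => (measurable_fderiv ℝ (G k)).enorm.pow_const _)
      (fun k => Eventually.of_forall fun x => ?_) ?_ ?_
    · exact pow_le_pow_left' (enorm_le_coe.2 (hGd k x)) 2
    · rw [setLIntegral_const]
      exact ENNReal.mul_ne_top (by simp) hsf
    · filter_upwards [ae_restrict_of_ae hGdt] with x hx
      exact ((ENNReal.continuous_pow 2).tendsto _).comp hx.enorm
  calc ∫⁻ x in s, ‖f x - f ((2⁻¹ : ℝ) • x + (2⁻¹ : ℝ) • y)‖ₑ ^ 2 ∂μ
      = ∫⁻ x in s, liminf (fun k =>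
          ‖G k x - G k ((2⁻¹ : ℝ) • x + (2⁻¹ : ℝ) • y)‖ₑ ^ 2) atTop ∂μ := by
        refine lintegral_congr fun x => (Tendsto.liminf_eq ?_).symm
        exact ((ENNReal.continuous_pow 2).tendsto _).comp ((hGt x).sub (hGt _)).enorm
    _ ≤ liminf (fun k => ∫⁻ x in s,
          ‖G k x - G k ((2⁻¹ : ℝ) • x + (2⁻¹ : ℝ) • y)‖ₑ ^ 2 ∂μ) atTop := by
        refine lintegral_liminf_le fun k => ?_
        have := (hGs k).continuous
        exact (Continuous.enorm (by fun_prop)).measurable.pow_const _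
    _ ≤ liminf (fun k => ENNReal.ofReal (2 ^ Module.finrank ℝ E) * D ^ 2 *
          ∫⁻ x in s, ‖fderiv ℝ (G k) x‖ₑ ^ 2 ∂μ) atTop :=
        liminf_le_liminf (Eventually.of_forall fun k =>
          lintegral_sub_midpoint_sq_le_of_contDiff μ hs hsm hD
            ((hGs k).of_le (by exact_mod_cast le_top)) hy)
    _ = _ := Tendsto.liminf_eq <| ENNReal.Tendsto.const_mul h1 (Or.inr (by finiteness))

/-- A Poincaré inequality for functions bounded on a subset `A` of the convex set `s`. -/
theorem LipschitzWith.lintegral_sq_le_of_le_on {s A : Set E} (hs : Convex ℝ s)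
    (hsm : MeasurableSet s) (hsf : μ s ≠ ∞) {D : ℝ≥0} (hD : ∀ x ∈ s, ∀ y ∈ s, ‖y - x‖ ≤ D)
    (hA : A ⊆ s) (hAm : MeasurableSet A)
    {f : E → ℝ} {L : ℝ≥0} (hf : LipschitzWith L f) {c : ℝ≥0} (hc : ∀ y ∈ A, ‖f y‖ ≤ c) :
    μ A * ∫⁻ x in s, ‖f x‖ₑ ^ 2 ∂μ ≤
      32 * (ENNReal.ofReal (2 ^ Module.finrank ℝ E) * D ^ 2 * μ s *
        ∫⁻ x in s, ‖fderiv ℝ f x‖ₑ ^ 2 ∂μ) + 16 * (c ^ 2 * μ s * μ A) := by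
  set P : ℝ≥0∞ := ENNReal.ofReal (2 ^ Module.finrank ℝ E) * D ^ 2 *
    ∫⁻ x in s, ‖fderiv ℝ f x‖ₑ ^ 2 ∂μ with hP
  have hmid : ∀ y ∈ s, ∫⁻ x in s, ‖f x - f ((2⁻¹ : ℝ) • x + (2⁻¹ : ℝ) • y)‖ₑ ^ 2 ∂μ ≤ P :=
    fun y hy => hf.lintegral_sub_midpoint_sq_le μ hs hsm hsf hD hy
  have hfc := hf.continuous
  have hm1 : Measurable fun p : E × E => ‖f p.1 - f ((2⁻¹ : ℝ) • p.1 + (2⁻¹ : ℝ) • p.2)‖ₑ ^ 2 :=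
    (Continuous.enorm (by fun_prop)).measurable.pow_const _
  have hpt : ∀ y ∈ A, ∀ x, ‖f x‖ₑ ^ 2 ≤
      16 * (‖f x - f ((2⁻¹ : ℝ) • x + (2⁻¹ : ℝ) • y)‖ₑ ^ 2 +
        ‖f y - f ((2⁻¹ : ℝ) • y + (2⁻¹ : ℝ) • x)‖ₑ ^ 2 + c ^ 2) := by
    intro y hy x
    have hy' := hc y hy
    rw [add_comm ((2⁻¹ : ℝ) • y)]
    set m := f ((2⁻¹ : ℝ) • x + (2⁻¹ : ℝ) • y)
    have hreal : ‖f x‖ ^ 2 ≤ 16 * (‖f x - m‖ ^ 2 + ‖f y - m‖ ^ 2 + c ^ 2) := by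
      have h3 : ‖f x‖ ≤ ‖f x - m‖ + ‖f y - m‖ + c := by
        calc ‖f x‖ = ‖(f x - m) - (f y - m) + f y‖ := by congr 1; ring
          _ ≤ ‖f x - m‖ + ‖f y - m‖ + ‖f y‖ :=
            (norm_add_le (f x - m - (f y - m)) (f y)).trans
              (by gcongr; exact _root_.norm_sub_le (f x - m) (f y - m))
          _ ≤ _ := by gcongr
      have h4 := pow_le_pow_left₀ (norm_nonneg (f x)) h3 2
      nlinarith [sq_nonneg (‖f x - m‖ - ‖f y - m‖), sq_nonneg (‖f x - m‖ - c),
        sq_nonneg (‖f y - m‖ - c), sq_nonneg (‖f x - m‖), sq_nonneg (‖f y - m‖), sq_nonneg (c : ℝ)]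
    have hnn : ‖f x‖₊ ^ 2 ≤ 16 * (‖f x - m‖₊ ^ 2 + ‖f y - m‖₊ ^ 2 + c ^ 2) := by
      exact_mod_cast hreal
    simp only [enorm_eq_nnnorm]
    exact_mod_cast hnn
  calc μ A * ∫⁻ x in s, ‖f x‖ₑ ^ 2 ∂μ = ∫⁻ _ in A, ∫⁻ x in s, ‖f x‖ₑ ^ 2 ∂μ ∂μ := by
        rw [setLIntegral_const, mul_comm]
    _ ≤ ∫⁻ y in A, ∫⁻ x in s, 16 * (‖f x - f ((2⁻¹ : ℝ) • x + (2⁻¹ : ℝ) • y)‖ₑ ^ 2 +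
        ‖f y - f ((2⁻¹ : ℝ) • y + (2⁻¹ : ℝ) • x)‖ₑ ^ 2 + c ^ 2) ∂μ ∂μ :=
        setLIntegral_mono' hAm fun y hy => lintegral_mono fun x => hpt y hy x
    _ = 16 * ((∫⁻ y in A, ∫⁻ x in s, ‖f x - f ((2⁻¹ : ℝ) • x + (2⁻¹ : ℝ) • y)‖ₑ ^ 2 ∂μ ∂μ) +
          (∫⁻ y in A, ∫⁻ x in s, ‖f y - f ((2⁻¹ : ℝ) • y + (2⁻¹ : ℝ) • x)‖ₑ ^ 2 ∂μ ∂μ) +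
          c ^ 2 * μ s * μ A) := by
        have e : ∀ y, ∫⁻ x in s, 16 * (‖f x - f ((2⁻¹ : ℝ) • x + (2⁻¹ : ℝ) • y)‖ₑ ^ 2 +
            ‖f y - f ((2⁻¹ : ℝ) • y + (2⁻¹ : ℝ) • x)‖ₑ ^ 2 + c ^ 2) ∂μ =
            16 * ((∫⁻ x in s, ‖f x - f ((2⁻¹ : ℝ) • x + (2⁻¹ : ℝ) • y)‖ₑ ^ 2 ∂μ) +
            (∫⁻ x in s, ‖f y - f ((2⁻¹ : ℝ) • y + (2⁻¹ : ℝ) • x)‖ₑ ^ 2 ∂μ) + c ^ 2 * μ s) := by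
          intro y
          have hm : Measurable fun x => ‖f x - f ((2⁻¹ : ℝ) • x + (2⁻¹ : ℝ) • y)‖ₑ ^ 2 :=
            (Continuous.enorm (by fun_prop)).measurable.pow_const _
          rw [lintegral_const_mul' _ _ (by norm_num), lintegral_add_right _ measurable_const,
            lintegral_add_left hm, setLIntegral_const]
        simp_rw [e]
        rw [lintegral_const_mul' _ _ (by norm_num), lintegral_add_right _ measurable_const,
          lintegral_add_left, setLIntegral_const]
        exact Measurable.lintegral_prod_left hm1
    _ ≤ 16 * (P * μ s + P * μ s + c ^ 2 * μ s * μ A) := by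
        gcongr
        · calc _ ≤ ∫⁻ _ in A, P ∂μ := setLIntegral_mono' hAm fun y hy => hmid y (hA hy)
            _ ≤ P * μ s := by
              rw [setLIntegral_const]
              gcongr
        · rw [lintegral_lintegral_swap hm1.aemeasurable]
          calc _ ≤ ∫⁻ _ in s, P ∂μ := 
                setLIntegral_mono' hsm fun x hx => (lintegral_mono_set hA).trans (hmid x hx)
            _ = P * μ s := setLIntegral_const _ _
    _ = _ := by
        rw [hP]
        ring

end Poincare

section Moser

theorem LipschitzWith.exists_mul_of_bounded {X : Type*} [PseudoMetricSpace X] {f g : X → ℝ}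
    {L L' : ℝ≥0} (hf : LipschitzWith L f) (hg : LipschitzWith L' g) {a b : ℝ≥0}
    (hfa : ∀ x, |f x| ≤ a) (hgb : ∀ x, |g x| ≤ b) :
    LipschitzWith (a * L' + b * L) fun x => f x * g x := by
  refine LipschitzWith.of_dist_le_mul fun x y => ?_
  have h1 := hf.dist_le_mul x y
  have h2 := hg.dist_le_mul x y
  rw [Real.dist_eq] at h1 h2 ⊢
  calc |f x * g x - f y * g y| = |f x * (g x - g y) + g y * (f x - f y)| := by congr 1; ring
    _ ≤ |f x| * |g x - g y| + |g y| * |f x - f y| := by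
      rw [← abs_mul, ← abs_mul]; exact abs_add_le _ _
    _ ≤ a * (L' * dist x y) + b * (L * dist x y) := by
      gcongr
      exacts [hfa x, hgb y]
    _ = _ := by push_cast; ring

theorem LipschitzWith.exists_comp_contDiffOn {X : Type*} [PseudoMetricSpace X] {f : X → ℝ}
    {L : ℝ≥0} (hf : LipschitzWith L f) {a b : ℝ} (hfa : ∀ x, f x ∈ Set.Icc a b) {θ : ℝ → ℝ}
    (hθ : ContDiffOn ℝ 1 θ (Set.Icc a b)) : ∃ K : ℝ≥0, LipschitzWith K fun x => θ (f x) := by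
  obtain ⟨K, hK⟩ := hθ.exists_lipschitzOnWith one_ne_zero (convex_Icc a b) isCompact_Icc
  refine ⟨K * L, ?_⟩
  rw [← lipschitzOnWith_univ]
  exact hK.comp (lipschitzOnWith_univ.2 hf) fun x _ => hfa x

theorem iteration_bound {a : ℕ → ℝ} {C b κ : ℝ} (hC : 0 < C) (hb : 1 ≤ b) (hκ : 1 < κ)
    (ha : ∀ j, 0 ≤ a j) (h : ∀ j, a (j + 1) ≤ (C * b ^ j * a j) ^ κ) (j : ℕ) :
    a j ≤ ((C ^ κ * b ^ (κ / (κ - 1))) ^ (1 / (κ - 1)) * a 0) ^ (κ ^ j) /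
      (C ^ κ * b ^ (κ / (κ - 1))) ^ (1 / (κ - 1)) := by
  have hκ1 : 0 < κ - 1 := by linarith
  have hb0 : 0 < b := by linarith
  set γ := b ^ (κ / (κ - 1)) with hγ
  have hγ1 : 1 ≤ γ := Real.one_le_rpow hb (by positivity)
  have hγ0 : 0 < γ := by linarith
  have hγκ : γ ^ κ = γ * b ^ κ := by
    rw [hγ, ← Real.rpow_mul hb0.le, ← Real.rpow_add hb0]
    congr 1; field_simp; ring
  set c := (C ^ κ * γ) ^ (1 / (κ - 1)) with hc
  have hc0 : 0 < c := by positivity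
  have hcκ : c ^ κ = c * (C ^ κ * γ) := by
    have : C ^ κ * γ = c ^ (κ - 1) := by
      rw [hc, ← Real.rpow_mul (by positivity), one_div_mul_cancel hκ1.ne', Real.rpow_one]
    rw [this, Real.rpow_sub_one hc0.ne']; field_simp
  have key : ∀ j, c * γ ^ j * a j ≤ (c * a 0) ^ (κ ^ j) := by
    intro j
    induction j with
    | zero => simp
    | succ j ih =>
      have haj := ha j
      calc c * γ ^ (j + 1) * a (j + 1) ≤ c * γ ^ (j + 1) * (C * b ^ j * a j) ^ κ := by
            gcongr; exact h j
        _ = (c * γ ^ j * a j) ^ κ := by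
            rw [Real.mul_rpow (by positivity) haj, Real.mul_rpow (by positivity) (by positivity),
              Real.mul_rpow (by positivity) haj, Real.mul_rpow (by positivity) (by positivity),
              hcκ, ← Real.rpow_pow_comm hγ0.le, hγκ, ← Real.rpow_pow_comm hb0.le]
            ring
        _ ≤ ((c * a 0) ^ (κ ^ j)) ^ κ := by
            have := ha 0
            gcongr
        _ = _ := by
            rw [← Real.rpow_mul (mul_nonneg hc0.le (ha 0)), pow_succ]
  rw [le_div_iff₀ hc0]
  refine le_trans ?_ (key j)
  have := one_le_pow₀ hγ1 (n := j)
  nlinarith [mul_nonneg (ha j) hc0.le]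

variable {E : Type*} [NormedAddCommGroup E] [NormedSpace ℝ E]

theorem exists_lipschitz_cutoff (x₁ : E) {ρ' ρ : ℝ} (h : ρ' < ρ) :
    ∃ η : E → ℝ, (∃ L, LipschitzWith L η) ∧ (∀ x, 0 ≤ η x) ∧ (∀ x, η x ≤ 1) ∧
      (∀ x ∈ closedBall x₁ ρ', η x = 1) ∧ tsupport η ⊆ closedBall x₁ ρ ∧
      ∀ x, ‖fderiv ℝ η x‖ ≤ 1 / (ρ - ρ') := by
  have hρ : 0 < ρ - ρ' := sub_pos.2 h
  have hL : LipschitzWith (1 / (ρ - ρ')).toNNReal fun x => max 0 (min 1 ((ρ - dist x x₁) / (ρ - ρ'))) := by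
    refine LipschitzWith.const_max (LipschitzWith.const_min ?_ 1) 0
    refine LipschitzWith.of_dist_le_mul fun x y => ?_
    rw [Real.coe_toNNReal _ (by positivity), Real.dist_eq, ← sub_div, abs_div, abs_of_pos hρ,
      one_div_mul_eq_div]
    gcongr
    rw [sub_sub_sub_cancel_left, abs_sub_comm]
    exact abs_dist_sub_le _ _ _
  refine ⟨_, ⟨_, hL⟩, fun x => le_max_left _ _, fun x => max_le zero_le_one (min_le_left _ _),
    fun x hx => ?_, ?_, fun x => ?_⟩
  · rw [min_eq_left, max_eq_right zero_le_one]
    rw [one_le_div hρ]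
    linarith [mem_closedBall.1 hx]
  · refine closure_minimal (fun x hx => ?_) isClosed_closedBall
    by_contra hx'
    rw [mem_closedBall, not_le] at hx'
    refine hx (max_eq_left ((min_le_right _ _).trans ?_))
    exact div_nonpos_of_nonpos_of_nonneg (by linarith) hρ.le
  · refine (norm_fderiv_le_of_lipschitz ℝ hL).trans ?_
    rw [Real.coe_toNNReal _ (by positivity)]

variable [MeasurableSpace E] [BorelSpace E] (μ : Measure E)

/-- The energy estimate satisfied by `log (1 / u)` for a nonnegative supersolution `u`. -/
def LogEnergyBound (s : Set E) (C : ℝ≥0) (f : E → ℝ) : Prop :=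
  ∀ m : ℝ, 0 ≤ m → ∀ (η : E → ℝ) (L : ℝ≥0), LipschitzWith L η → HasCompactSupport η →
    tsupport η ⊆ s → (∀ x, 0 ≤ η x) → (∀ x, η x ≤ 1) →
      ∫⁻ x, ENNReal.ofReal (η x ^ 2 * f x ^ m * ‖fderiv ℝ f x‖ ^ 2) ∂μ ≤
        ENNReal.ofReal (C * (1 + m)) *
          ∫⁻ x, ENNReal.ofReal ((η x ^ 2 + ‖fderiv ℝ η x‖ ^ 2) * f x ^ m) ∂μ

theorem lintegral_cutoff_le {f η : E → ℝ} {x₁ : E} {ρ e : ℝ} (hη0 : ∀ x, 0 ≤ η x)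
    (hη1 : ∀ x, η x ≤ 1) (hηs : tsupport η ⊆ closedBall x₁ ρ) (he : ∀ x, ‖fderiv ℝ η x‖ ≤ e)
    (hf : ∀ x, 0 ≤ f x) :
    ∫⁻ x, ENNReal.ofReal ((η x ^ 2 + ‖fderiv ℝ η x‖ ^ 2) * f x) ∂μ ≤
      ENNReal.ofReal (1 + e ^ 2) * ∫⁻ x in closedBall x₁ ρ, ENNReal.ofReal (f x) ∂μ := by
  rw [← lintegral_const_mul' _ _ ENNReal.ofReal_ne_top,
    ← lintegral_indicator isClosed_closedBall.measurableSet]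
  refine lintegral_mono fun x => ?_
  by_cases hx : x ∈ closedBall x₁ ρ
  · rw [Set.indicator_of_mem hx, ← ENNReal.ofReal_mul (by positivity)]
    have := hf x
    have := hη0 x
    gcongr
    · exact pow_le_one₀ (hη0 x) (hη1 x)
    · exact he x
  · have h1 : x ∉ tsupport η := fun h => hx (hηs h)
    rw [image_eq_zero_of_notMem_tsupport h1,
      Function.notMem_support.1 (fun h => h1 (support_fderiv_subset ℝ h))]
    simp

variable [FiniteDimensional ℝ E] [μ.IsAddHaarMeasure]

theorem LogEnergyBound.reverse_holder {s : Set E} {C : ℝ≥0} {f : E → ℝ}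
    (hE : LogEnergyBound μ s C f) {L : ℝ≥0} (hf : LipschitzWith L f) {T : ℝ}
    (hfT : ∀ x, f x ∈ Set.Icc 1 T) {κ : ℝ} (hκ : 1 < κ) {Cs : ℝ≥0}
    (hS : ∀ (g : E → ℝ) (L : ℝ≥0), LipschitzWith L g → HasCompactSupport g →
      ∫⁻ x, ‖g x‖ₑ ^ κ ∂μ ≤ Cs * ((∫⁻ x, ‖fderiv ℝ g x‖ₑ ∂μ) + ∫⁻ x, ‖g x‖ₑ ∂μ) ^ κ)
    {q : ℝ} (hq : 2 ≤ q) {x₁ : E} {ρ' ρ : ℝ} (hρ : ρ' < ρ) (hs : closedBall x₁ ρ ⊆ s) :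
    ∫⁻ x in closedBall x₁ ρ', ENNReal.ofReal (f x ^ (q * κ)) ∂μ ≤
      Cs * (ENNReal.ofReal ((1 + C) * q ^ 2 * (1 + (1 / (ρ - ρ')) ^ 2)) *
        ∫⁻ x in closedBall x₁ ρ, ENNReal.ofReal (f x ^ q) ∂μ) ^ κ := by
  obtain ⟨η, ⟨Lη, hηL⟩, hη0, hη1, hη', hηs, hηe⟩ := exists_lipschitz_cutoff x₁ hρ
  have hf0 : ∀ x, 0 < f x := fun x => zero_lt_one.trans_le (hfT x).1
  have hηc : HasCompactSupport η := (isCompact_closedBall x₁ ρ).of_isClosed_subset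
    (isClosed_tsupport η) hηs
  have habs : ∀ x, |η x| ≤ (1 : ℝ≥0) := fun x => by
    rw [abs_of_nonneg (hη0 x)]; exact hη1 x
  have hη2 := hηL.exists_mul_of_bounded hηL habs habs
  obtain ⟨K, hK⟩ := hf.exists_comp_contDiffOn hfT (θ := fun s => s ^ q)
    (contDiffOn_id.rpow_const_of_ne fun x hx => (zero_lt_one.trans_le hx.1).ne')
  set g : E → ℝ := fun x => η x ^ 2 * f x ^ q with hg
  have hgL : ∃ L', LipschitzWith L' g := by
    have := hη2.exists_mul_of_bounded hK (a := 1) (b := (T ^ q).toNNReal) (fun x => ?_)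
      (fun x => ?_)
    · exact ⟨_, by simpa only [hg, sq] using this⟩
    · rw [abs_mul]; exact mul_le_one₀ (habs x) (abs_nonneg _) (habs x)
    · rw [abs_of_pos (Real.rpow_pos_of_pos (hf0 x) q)]
      refine le_trans ?_ (Real.le_coe_toNNReal _)
      exact Real.rpow_le_rpow (hf0 x).le (hfT x).2 (by linarith)
  obtain ⟨L', hgL⟩ := hgL
  have hgc : HasCompactSupport g := by
    refine hηc.mono fun x hx => ?_
    contrapose! hx
    simp only [Function.mem_support, not_not] at hx ⊢
    simp [hg, hx]
  have hg0 : ∀ x, 0 ≤ g x := fun x => by have := hf0 x; positivity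
  have hpt : ∀ᵐ x ∂μ, ‖fderiv ℝ g x‖ + g x ≤
      (2 + q / 2) * ((η x ^ 2 + ‖fderiv ℝ η x‖ ^ 2) * f x ^ q) +
        q / 2 * (η x ^ 2 * f x ^ (q - 2) * ‖fderiv ℝ f x‖ ^ 2) := by
    filter_upwards [hf.ae_differentiableAt (μ := μ), hηL.ae_differentiableAt (μ := μ)] with x h1 h2
    have hd := (h2.hasFDerivAt.pow 2).mul (h1.hasFDerivAt.rpow_const (p := q) (Or.inl (hf0 x).ne'))
    have hd' : fderiv ℝ g x = _ := hd.fderiv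
    have hp := Real.rpow_pos_of_pos (hf0 x) (q - 2)
    have e1 : f x ^ (q - 1) = f x ^ (q - 2) * f x := by
      rw [← Real.rpow_add_one (hf0 x).ne']; congr 1; ring
    have e2 : f x ^ q = f x ^ (q - 2) * f x ^ 2 := by
      rw [← Real.rpow_natCast, ← Real.rpow_add (hf0 x)]; congr 1; push_cast; ring
    have hη0x := hη0 x
    have hf0x := hf0 x
    have hn : ‖fderiv ℝ g x‖ ≤ η x ^ 2 * (q * f x ^ (q - 1) * ‖fderiv ℝ f x‖) +
        f x ^ q * (2 * η x * ‖fderiv ℝ η x‖) := by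
      rw [hd']
      refine (norm_add_le _ _).trans ?_
      rw [norm_smul, norm_smul, norm_smul, norm_smul]
      have : 0 ≤ f x ^ (q - 1) := (Real.rpow_pos_of_pos (hf0 x) _).le
      have : 0 ≤ f x ^ q := (Real.rpow_pos_of_pos (hf0 x) _).le
      refine le_of_eq ?_
      rw [Real.norm_of_nonneg, Real.norm_of_nonneg, Real.norm_of_nonneg, Real.norm_of_nonneg]
      · simp
      all_goals positivity
    rw [e1] at hn
    rw [e2] at hn ⊢
    have hgx : g x = η x ^ 2 * (f x ^ (q - 2) * f x ^ 2) := by rw [← e2]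
    rw [hgx]
    generalize f x ^ (q - 2) = P at *
    generalize ‖fderiv ℝ η x‖ = e at *
    generalize ‖fderiv ℝ f x‖ = a at *
    have key : 0 ≤ P * (q / 2 * (η x * (f x - a)) ^ 2 + (f x * (η x - e)) ^ 2 +
        (q / 2 + 1) * (f x * e) ^ 2 - (f x * e) ^ 2 + (f x * e) ^ 2) := by
      have : 0 ≤ q / 2 * (η x * (f x - a)) ^ 2 + (f x * (η x - e)) ^ 2 +
        q / 2 * (f x * e) ^ 2 + (f x * e) ^ 2 := by positivity
      exact mul_nonneg hp.le (by linarith)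
    linarith
  set J := ∫⁻ x, ENNReal.ofReal ((η x ^ 2 + ‖fderiv ℝ η x‖ ^ 2) * f x ^ q) ∂μ with hJ
  have hJm : Measurable fun x => (η x ^ 2 + ‖fderiv ℝ η x‖ ^ 2) * f x ^ q := by
    have := hηL.continuous.measurable
    have := hf.continuous.measurable
    have := (measurable_fderiv ℝ η).norm
    fun_prop
  have hen : ∫⁻ x, ENNReal.ofReal (η x ^ 2 * f x ^ (q - 2) * ‖fderiv ℝ f x‖ ^ 2) ∂μ ≤
      ENNReal.ofReal (C * (q - 1)) * J := by
    refine (hE (q - 2) (by linarith) η Lη hηL hηc (hηs.trans hs) hη0 hη1).trans ?_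
    rw [show 1 + (q - 2) = q - 1 by ring]
    refine mul_le_mul' le_rfl (lintegral_mono fun x => ENNReal.ofReal_le_ofReal ?_)
    gcongr
    · exact (hfT x).1
    · linarith
  have hsum : (∫⁻ x, ‖fderiv ℝ g x‖ₑ ∂μ) + ∫⁻ x, ‖g x‖ₑ ∂μ ≤
      ENNReal.ofReal ((1 + C) * q ^ 2) * J := by
    calc (∫⁻ x, ‖fderiv ℝ g x‖ₑ ∂μ) + ∫⁻ x, ‖g x‖ₑ ∂μ
        = ∫⁻ x, ENNReal.ofReal (‖fderiv ℝ g x‖ + g x) ∂μ := by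
          rw [← lintegral_add_right _ hgL.continuous.enorm.measurable]
          refine lintegral_congr fun x => ?_
          rw [ENNReal.ofReal_add (norm_nonneg _) (hg0 x), ofReal_norm,
            Real.enorm_of_nonneg (hg0 x)]
      _ ≤ ∫⁻ x, (ENNReal.ofReal (2 + q / 2) *
            ENNReal.ofReal ((η x ^ 2 + ‖fderiv ℝ η x‖ ^ 2) * f x ^ q) + ENNReal.ofReal (q / 2) *
            ENNReal.ofReal (η x ^ 2 * f x ^ (q - 2) * ‖fderiv ℝ f x‖ ^ 2)) ∂μ := by
          refine lintegral_mono_ae (hpt.mono fun x hx => ?_)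
          have := hf0 x
          rw [← ENNReal.ofReal_mul (by positivity), ← ENNReal.ofReal_mul (by positivity),
            ← ENNReal.ofReal_add (by positivity) (by positivity)]
          exact ENNReal.ofReal_le_ofReal hx
      _ = ENNReal.ofReal (2 + q / 2) * J + ENNReal.ofReal (q / 2) *
            ∫⁻ x, ENNReal.ofReal (η x ^ 2 * f x ^ (q - 2) * ‖fderiv ℝ f x‖ ^ 2) ∂μ := by
          rw [lintegral_add_left (hJm.ennreal_ofReal.const_mul _),
            lintegral_const_mul' _ _ ENNReal.ofReal_ne_top,
            lintegral_const_mul' _ _ ENNReal.ofReal_ne_top]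
      _ ≤ ENNReal.ofReal (2 + q / 2) * J + ENNReal.ofReal (q / 2) *
            (ENNReal.ofReal (C * (q - 1)) * J) := by gcongr
      _ = ENNReal.ofReal (2 + q / 2 + q / 2 * (C * (q - 1))) * J := by
          have : 0 ≤ (C : ℝ) * (q - 1) := mul_nonneg C.2 (by linarith)
          rw [← mul_assoc, ← ENNReal.ofReal_mul (by positivity), ← add_mul,
            ← ENNReal.ofReal_add (by positivity) (by positivity)]
      _ ≤ _ := by
          gcongr
          nlinarith [mul_nonneg C.2 (by positivity : 0 ≤ q ^ 2), mul_nonneg C.2 (by positivity : 0 ≤ q)]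
  calc ∫⁻ x in closedBall x₁ ρ', ENNReal.ofReal (f x ^ (q * κ)) ∂μ
      = ∫⁻ x in closedBall x₁ ρ', ‖g x‖ₑ ^ κ ∂μ := by
        refine setLIntegral_congr_fun isClosed_closedBall.measurableSet fun x hx => ?_
        have h1 : 0 ≤ f x ^ q := Real.rpow_nonneg (hf0 x).le q
        simp only [hg, hη' x hx, one_pow, one_mul]
        rw [Real.enorm_of_nonneg h1, ENNReal.ofReal_rpow_of_nonneg h1 (by linarith),
          Real.rpow_mul (hf0 x).le]
    _ ≤ ∫⁻ x, ‖g x‖ₑ ^ κ ∂μ := setLIntegral_le_lintegral _ _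
    _ ≤ _ := hS g L' hgL hgc
    _ ≤ _ := by
        gcongr
        refine hsum.trans ?_
        rw [ENNReal.ofReal_mul (q := 1 + (1 / (ρ - ρ')) ^ 2) (by positivity), mul_assoc]
        gcongr
        exact lintegral_cutoff_le μ hη0 hη1 hηs hηe fun x => Real.rpow_nonneg (hf0 x).le q

theorem LogEnergyBound.exists_sq_le_lintegral [Nontrivial E] (C : ℝ≥0) {R : ℝ} (hR : 0 < R) :
    ∃ c : ℝ, 0 < c ∧ ∀ (x₁ : E) (f : E → ℝ) (L : ℝ≥0) (T : ℝ), LipschitzWith L f →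
      (∀ x, f x ∈ Set.Icc 1 T) → LogEnergyBound μ (ball x₁ (4 * R)) C f →
        f x₁ ^ 2 ≤ c * (∫⁻ x in closedBall x₁ (2 * R), ENNReal.ofReal (f x ^ 2) ∂μ).toReal := by
  obtain ⟨κ, hκ, Cs, hS⟩ := exists_lintegral_rpow_le_of_lipschitz μ
  have hκ0 : 0 < κ := by linarith
  set C₃ : ℝ := 4 * (1 + C) * (1 + 4 / R ^ 2) with hC₃
  set C₄ : ℝ := (1 + Cs) * C₃ with hC₄
  set b : ℝ := 4 * κ ^ 2 with hb
  have hC₃0 : 0 < C₃ := by positivity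
  have hC₄0 : 0 < C₄ := by positivity
  set c : ℝ := (C₄ ^ κ * b ^ (κ / (κ - 1))) ^ (1 / (κ - 1)) with hc
  have hc0 : 0 < c := by positivity
  refine ⟨c, hc0, fun x₁ f L T hf hfT hE => ?_⟩
  have hf0 : ∀ x, 0 < f x := fun x => zero_lt_one.trans_le (hfT x).1
  have hT0 : 0 < T := (hf0 x₁).trans_le (hfT x₁).2
  set ρ : ℕ → ℝ := fun j => R * (1 + 2⁻¹ ^ j) with hρ
  set I : ℕ → ℝ≥0∞ := fun j =>
    ∫⁻ x in closedBall x₁ (ρ j), ENNReal.ofReal (f x ^ (2 * κ ^ j)) ∂μ with hI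
  have hfin : ∀ j, I j ≠ ∞ := fun j => by
    refine ne_top_of_le_ne_top ?_ (lintegral_mono (g := fun _ => ENNReal.ofReal (T ^ (2 * κ ^ j)))
      fun x => ENNReal.ofReal_le_ofReal ?_)
    · rw [setLIntegral_const]
      exact ENNReal.mul_ne_top ENNReal.ofReal_ne_top
        (isCompact_closedBall x₁ (ρ j)).measure_lt_top.ne
    · exact Real.rpow_le_rpow (hf0 x).le (hfT x).2 (by positivity)
  have hstep : ∀ j, (I (j + 1)).toReal ≤ (C₄ * b ^ j * (I j).toReal) ^ κ := by
    intro j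
    have hpow : (0 : ℝ) < 2⁻¹ ^ j := by positivity
    have hpow1 : (2⁻¹ : ℝ) ^ j ≤ 1 := pow_le_one₀ (by norm_num) (by norm_num)
    have hsub : ρ j - ρ (j + 1) = R * 2⁻¹ ^ j / 2 := by simp only [hρ, pow_succ]; ring
    have hκj : 1 ≤ κ ^ j := one_le_pow₀ hκ.le
    have h := hE.reverse_holder μ hf hfT hκ hS (q := 2 * κ ^ j) (by linarith) (x₁ := x₁)
      (ρ' := ρ (j + 1)) (ρ := ρ j) (by
        have : 0 < R * 2⁻¹ ^ j / 2 := by positivity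
        linarith) (closedBall_subset_ball (by simp only [hρ]; nlinarith))
    have hcoef : (1 + C) * (2 * κ ^ j) ^ 2 * (1 + (1 / (ρ j - ρ (j + 1))) ^ 2) ≤ C₃ * b ^ j := by
      have e1 : (1 / (ρ j - ρ (j + 1))) ^ 2 = 4 / R ^ 2 * 4 ^ j := by
        rw [hsub]
        have : (4 : ℝ) ^ j = (2⁻¹ ^ j)⁻¹ ^ 2 := by
          rw [← inv_pow, inv_inv, ← pow_mul, mul_comm, pow_mul]; norm_num
        rw [this]
        field_simp
        norm_num
      have e2 : (1 : ℝ) ≤ 4 ^ j := one_le_pow₀ (by norm_num)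
      rw [e1, hC₃, hb, mul_pow 4, ← pow_mul, mul_comm 2 j, pow_mul]
      calc (1 + (C : ℝ)) * (2 * κ ^ j) ^ 2 * (1 + 4 / R ^ 2 * 4 ^ j)
          ≤ (1 + C) * (2 * κ ^ j) ^ 2 * (4 ^ j + 4 / R ^ 2 * 4 ^ j) := by gcongr
        _ = _ := by ring
    have h' : I (j + 1) ≤ Cs * (ENNReal.ofReal (C₃ * b ^ j) * I j) ^ κ := by
      refine le_trans (le_of_eq ?_) (h.trans ?_)
      · simp only [hI]
        rw [pow_succ, mul_assoc]
      · gcongr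
    have h'' := ENNReal.toReal_mono (ENNReal.mul_ne_top ENNReal.coe_ne_top
      (ENNReal.rpow_ne_top_of_nonneg hκ0.le
        (ENNReal.mul_ne_top ENNReal.ofReal_ne_top (hfin j)))) h'
    rw [ENNReal.toReal_mul, ← ENNReal.toReal_rpow, ENNReal.toReal_mul,
      ENNReal.toReal_ofReal (by positivity), ENNReal.coe_toReal] at h''
    refine h''.trans ?_
    have hX : 0 ≤ C₃ * b ^ j * (I j).toReal := by positivity
    rw [hC₄, mul_assoc (1 + (Cs : ℝ)), mul_assoc (1 + (Cs : ℝ)),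
      Real.mul_rpow (by positivity) hX]
    gcongr
    calc (Cs : ℝ) ≤ 1 + Cs := by linarith
      _ = (1 + Cs : ℝ) ^ (1 : ℝ) := (Real.rpow_one _).symm
      _ ≤ _ := Real.rpow_le_rpow_of_exponent_le (by linarith [Cs.2]) hκ.le
  have hb1 : 1 ≤ b := by nlinarith
  have hbound := iteration_bound (a := fun j => (I j).toReal) hC₄0 hb1 hκ
    (fun j => ENNReal.toReal_nonneg) hstep
  have hI0 : I 0 = ∫⁻ x in closedBall x₁ (2 * R), ENNReal.ofReal (f x ^ 2) ∂μ := by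
    simp only [hI, hρ, pow_zero, mul_one]
    norm_num [mul_comm]
  rw [← hI0]
  by_contra! hlt
  obtain ⟨τ, hτ1, hτ2⟩ := exists_between hlt
  have hN0 : 0 ≤ c * (I 0).toReal := by positivity
  have hτ0 : 0 < τ := hN0.trans_lt hτ1
  have hnhds : ∀ᶠ x in 𝓝 x₁, τ < f x ^ 2 :=
    (hf.continuous.pow 2).continuousAt.eventually (lt_mem_nhds hτ2)
  obtain ⟨δ, hδ, hδτ⟩ := Metric.eventually_nhds_iff_ball.1 hnhds
  set U := ball x₁ (min δ R) with hU
  have hU0 : 0 < μ U := measure_ball_pos μ x₁ (lt_min hδ hR)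
  have hUfin : μ U ≠ ∞ := measure_ball_lt_top.ne
  have hlow : ∀ j, (μ U).toReal * τ ^ (κ ^ j) ≤ (I j).toReal := by
    intro j
    have : ENNReal.ofReal (τ ^ (κ ^ j)) * μ U ≤ I j := by
      rw [← setLIntegral_const]
      calc ∫⁻ _ in U, ENNReal.ofReal (τ ^ (κ ^ j)) ∂μ
          ≤ ∫⁻ x in U, ENNReal.ofReal (f x ^ (2 * κ ^ j)) ∂μ := by
            refine setLIntegral_mono' measurableSet_ball fun x hx => ?_
            refine ENNReal.ofReal_le_ofReal ?_
            rw [Real.rpow_mul (hf0 x).le]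
            refine Real.rpow_le_rpow hτ0.le ?_ (by positivity)
            have := hδτ x (ball_subset_ball (min_le_left _ _) hx)
            exact_mod_cast this.le
        _ ≤ I j := by
            refine lintegral_mono_set (ball_subset_closedBall.trans (closedBall_subset_closedBall ?_))
            refine (min_le_right _ _).trans ?_
            have : (0 : ℝ) < R * 2⁻¹ ^ j := by positivity
            simp only [hρ]; linarith
    have h2 := ENNReal.toReal_mono (hfin j) this
    rw [ENNReal.toReal_mul, ENNReal.toReal_ofReal (by positivity)] at h2
    linarith
  have hm : 0 < (μ U).toReal := ENNReal.toReal_pos hU0.ne' hUfin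
  have hlim : Tendsto (fun j : ℕ => (c * (I 0).toReal / τ) ^ (κ ^ j)) atTop (𝓝 0) :=
    (tendsto_rpow_atTop_of_base_lt_one _ (by linarith [div_nonneg hN0 hτ0.le])
      ((div_lt_one hτ0).2 hτ1)).comp (tendsto_pow_atTop_atTop_of_one_lt hκ)
  have hge : ∀ j : ℕ, (μ U).toReal * c ≤ (c * (I 0).toReal / τ) ^ (κ ^ j) := by
    intro j
    have h1 := (hlow j).trans (hbound j)
    rw [le_div_iff₀ hc0] at h1
    rw [Real.div_rpow hN0 hτ0.le, le_div_iff₀ (by positivity)]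
    linarith
  have := ge_of_tendsto' hlim hge
  nlinarith [mul_pos hm hc0]

theorem LogEnergyBound.exists_lintegral_sq_le (C : ℝ≥0) {R : ℝ} (hR : 0 < R) (x₁ : E) {A : Set E}
    (hA : A ⊆ closedBall x₁ (2 * R)) (hAm : MeasurableSet A) (hA0 : μ A ≠ 0) (c : ℝ≥0) :
    ∃ N : ℝ≥0∞, N ≠ ∞ ∧ ∀ (f : E → ℝ) (L : ℝ≥0), LipschitzWith L f →
      LogEnergyBound μ (ball x₁ (4 * R)) C f → (∀ y ∈ A, ‖f y‖ ≤ c) →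
        ∫⁻ x in closedBall x₁ (2 * R), ENNReal.ofReal (f x ^ 2) ∂μ ≤ N := by
  have hsf : ∀ ρ, μ (closedBall x₁ ρ) ≠ ∞ := fun ρ =>
    (isCompact_closedBall x₁ ρ).measure_lt_top.ne
  set M : ℝ≥0∞ := ENNReal.ofReal C * (ENNReal.ofReal (1 + (1 / R) ^ 2) * μ (closedBall x₁ (3 * R)))
  have hM : M ≠ ∞ := ENNReal.mul_ne_top ENNReal.ofReal_ne_top
    (ENNReal.mul_ne_top ENNReal.ofReal_ne_top (hsf _))
  set D : ℝ≥0 := (4 * R).toNNReal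
  refine ⟨(32 * (ENNReal.ofReal (2 ^ Module.finrank ℝ E) * D ^ 2 * μ (closedBall x₁ (2 * R)) * M) +
    16 * (c ^ 2 * μ (closedBall x₁ (2 * R)) * μ A)) / μ A, ?_, fun f L hf hE hfc => ?_⟩
  · have := hsf (2 * R)
    have := measure_ne_top_of_subset hA this
    finiteness
  rw [ENNReal.le_div_iff_mul_le (Or.inl hA0) (Or.inl (measure_ne_top_of_subset hA (hsf _))), mul_comm]
  have hP := hf.lintegral_sq_le_of_le_on μ (convex_closedBall x₁ (2 * R))
    isClosed_closedBall.measurableSet (hsf _) (D := D) (fun x hx y hy => by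
      rw [← dist_eq_norm, Real.coe_toNNReal _ (by positivity)]
      have := dist_triangle_right y x x₁
      linarith [mem_closedBall.1 hx, mem_closedBall.1 hy]) hA hAm hfc
  have hgrad : ∫⁻ x in closedBall x₁ (2 * R), ‖fderiv ℝ f x‖ₑ ^ 2 ∂μ ≤ M := by
    obtain ⟨η, ⟨Lη, hηL⟩, hη0, hη1, hη', hηs, hηe⟩ :=
      exists_lipschitz_cutoff x₁ (by linarith : 2 * R < 3 * R)
    have h := hE 0 le_rfl η Lη hηL ((isCompact_closedBall x₁ _).of_isClosed_subset
      (isClosed_tsupport η) hηs) (hηs.trans (closedBall_subset_ball (by linarith))) hη0 hη1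
    simp only [Real.rpow_zero, add_zero, mul_one] at h
    have h1 := lintegral_cutoff_le μ (f := fun _ => 1) hη0 hη1 hηs hηe (fun _ => zero_le_one)
    simp only [mul_one, ENNReal.ofReal_one, setLIntegral_const, one_mul] at h1
    rw [show 3 * R - 2 * R = R by ring] at h1
    calc ∫⁻ x in closedBall x₁ (2 * R), ‖fderiv ℝ f x‖ₑ ^ 2 ∂μ
        = ∫⁻ x in closedBall x₁ (2 * R), ENNReal.ofReal (η x ^ 2 * ‖fderiv ℝ f x‖ ^ 2) ∂μ := by
          refine setLIntegral_congr_fun isClosed_closedBall.measurableSet fun x hx => ?_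
          simp only [hη' x hx, one_pow, one_mul]
          rw [ENNReal.ofReal_pow (norm_nonneg _), ofReal_norm]
      _ ≤ _ := setLIntegral_le_lintegral _ _
      _ ≤ _ := h
      _ ≤ M := mul_le_mul' le_rfl h1
  calc μ A * ∫⁻ x in closedBall x₁ (2 * R), ENNReal.ofReal (f x ^ 2) ∂μ
      = μ A * ∫⁻ x in closedBall x₁ (2 * R), ‖f x‖ₑ ^ 2 ∂μ := by
        congr 1
        refine lintegral_congr fun x => ?_
        rw [← sq_abs, ENNReal.ofReal_pow (abs_nonneg _), ← Real.norm_eq_abs, ofReal_norm]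
    _ ≤ _ := hP
    _ ≤ _ := by gcongr

/-- The local boundedness estimate of Moser's iteration for the logarithm of a supersolution. -/
theorem LogEnergyBound.exists_le [Nontrivial E] (C : ℝ≥0) {R : ℝ} (hR : 0 < R) (x₁ : E) {A : Set E}
    (hA : A ⊆ closedBall x₁ (2 * R)) (hAm : MeasurableSet A) (hA0 : μ A ≠ 0) (c : ℝ≥0) :
    ∃ N : ℝ, ∀ (f : E → ℝ) (L : ℝ≥0) (T : ℝ), LipschitzWith L f → (∀ x, f x ∈ Set.Icc 1 T) →
      LogEnergyBound μ (ball x₁ (4 * R)) C f → (∀ y ∈ A, f y ≤ c) → f x₁ ≤ N := by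
  obtain ⟨N, hN, h1⟩ := LogEnergyBound.exists_lintegral_sq_le μ C hR x₁ hA hAm hA0 c
  obtain ⟨k, hk, h2⟩ := LogEnergyBound.exists_sq_le_lintegral μ C hR
  refine ⟨k * N.toReal, fun f L T hf hfT hE hfc => ?_⟩
  have h3 := h2 x₁ f L T hf hfT hE
  have h4 := ENNReal.toReal_mono hN (h1 f L hf hE fun y hy => by
    rw [Real.norm_of_nonneg (zero_le_one.trans (hfT y).1)]; exact hfc y hy)
  have h5 := mul_le_mul_of_nonneg_left h4 hk.le
  nlinarith [(hfT x₁).1]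

end Moser

section Energy

theorem integrable_of_norm_le_of_support_subset {X V : Type*} [TopologicalSpace X] [T2Space X]
    [MeasurableSpace X] [BorelSpace X] [NormedAddCommGroup V]
    {μ : Measure X} [IsFiniteMeasureOnCompacts μ] {h : X → V} (hm : AEStronglyMeasurable h μ)
    {K : Set X} (hK : IsCompact K) (hs : Function.support h ⊆ K) {B : ℝ} (hB : ∀ x, ‖h x‖ ≤ B) :
    Integrable h μ := by
  rw [← integrableOn_iff_integrable_of_support_subset hs]
  exact Measure.integrableOn_of_bounded hK.measure_lt_top.ne hm (Eventually.of_forall hB)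

variable {E : Type*} [NormedAddCommGroup E] [NormedSpace ℝ E] [FiniteDimensional ℝ E]
  [MeasurableSpace E] [BorelSpace E] (μ : Measure E)

theorem aestronglyMeasurable_fderiv_apply {μ : Measure E} {G : E → E}
    (hG : AEStronglyMeasurable G μ) (φ : E → ℝ) :
    AEStronglyMeasurable (fun x => fderiv ℝ φ x (G x)) μ :=
  isBoundedBilinearMap_apply.continuous.comp_aestronglyMeasurable
    ((measurable_fderiv ℝ φ).aestronglyMeasurable.prodMk hG)

theorem integrable_fderiv_apply_add {μ : Measure E} [IsFiniteMeasureOnCompacts μ] {G : E → E}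
    {H : E → ℝ} (hG : AEStronglyMeasurable G μ) (hH : AEStronglyMeasurable H μ) {B : ℝ}
    (hGB : ∀ x, ‖G x‖ ≤ B) (hHB : ∀ x, ‖H x‖ ≤ B) {φ : E → ℝ} {L : ℝ≥0}
    (hφL : LipschitzWith L φ) (hφc : HasCompactSupport φ) :
    Integrable (fun x => fderiv ℝ φ x (G x) + H x * φ x) μ := by
  obtain ⟨b, hb⟩ := hφc.exists_bound_of_continuous hφL.continuous
  refine integrable_of_norm_le_of_support_subset
    ((aestronglyMeasurable_fderiv_apply hG _).add
      (hH.mul hφL.continuous.aestronglyMeasurable)) hφc (fun x hx => ?_)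
    (B := L * B + B * b) fun x => ?_
  · by_contra h
    refine hx ?_
    dsimp only
    rw [image_eq_zero_of_notMem_tsupport h,
      Function.notMem_support.1 (fun h' => h (support_fderiv_subset ℝ h'))]
    simp
  · have hB0 : 0 ≤ B := (norm_nonneg _).trans (hGB 0)
    refine (norm_add_le _ _).trans (add_le_add ?_ ?_)
    · refine (ContinuousLinearMap.le_opNorm _ _).trans ?_
      gcongr
      exacts [norm_fderiv_le_of_lipschitz ℝ hφL, hGB x]
    · rw [norm_mul]
      gcongr
      exacts [hHB x, hb x]

variable [μ.IsAddHaarMeasure]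

theorem integral_nonneg_of_lipschitz {s : Set E} (hs : IsOpen s) {G : E → E} {H : E → ℝ}
    (hG : AEStronglyMeasurable G μ) (hH : AEStronglyMeasurable H μ) {B : ℝ}
    (hGB : ∀ x, ‖G x‖ ≤ B) (hHB : ∀ x, ‖H x‖ ≤ B)
    (hweak : ∀ φ : E → ℝ, ContDiff ℝ (⊤ : ℕ∞) φ → HasCompactSupport φ → tsupport φ ⊆ s →
      (∀ x, 0 ≤ φ x) → 0 ≤ ∫ x, (fderiv ℝ φ x (G x) + H x * φ x) ∂μ)
    {φ : E → ℝ} {L : ℝ≥0} (hφ : LipschitzWith L φ) (hφc : HasCompactSupport φ)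
    (hφs : tsupport φ ⊆ s) (hφ0 : ∀ x, 0 ≤ φ x) :
    0 ≤ ∫ x, (fderiv ℝ φ x (G x) + H x * φ x) ∂μ := by
  obtain ⟨g, hgs, hgd, hg0, hgb, hgt, hgl, hgdl⟩ := hφ.exists_smooth_approx μ
  obtain ⟨δ, hδ, hδs⟩ := IsCompact.exists_cthickening_subset_open hφc hs hφs
  set K := cthickening δ (tsupport φ) with hK
  have hKc : IsCompact K := IsCompact.cthickening hφc
  obtain ⟨b, hb⟩ := hφc.exists_bound_of_continuous hφ.continuous
  have hB0 : 0 ≤ B := (norm_nonneg _).trans (hGB 0)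
  have hb' : ∀ k x, ‖g k x‖ ≤ b := fun k x => by
    rw [Real.norm_of_nonneg (hg0 k x 0 hφ0)]
    exact hgb k x b fun y => (le_abs_self _).trans (hb y)
  have hev : ∀ᶠ k : ℕ in atTop, tsupport (g k) ⊆ K := by
    have : ∀ᶠ k : ℕ in atTop, 1 / ((k : ℝ) + 1) < δ :=
      tendsto_one_div_add_atTop_nhds_zero_nat.eventually (gt_mem_nhds hδ)
    filter_upwards [this] with k hk
    exact (hgt k).trans (cthickening_mono hk.le _)
  have hlim : Tendsto (fun k => ∫ x, (fderiv ℝ (g k) x (G x) + H x * g k x) ∂μ) atTop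
      (𝓝 (∫ x, (fderiv ℝ φ x (G x) + H x * φ x) ∂μ)) := by
    refine tendsto_integral_filter_of_dominated_convergence
      (K.indicator fun _ => L * B + B * b) ?_ ?_ ?_ ?_
    · exact Eventually.of_forall fun k => (aestronglyMeasurable_fderiv_apply hG _).add
        (hH.mul (hgs k).continuous.aestronglyMeasurable)
    · filter_upwards [hev] with k hk
      refine Eventually.of_forall fun x => ?_
      by_cases hx : x ∈ K
      · rw [Set.indicator_of_mem hx]
        refine (norm_add_le _ _).trans (add_le_add ?_ ?_)
        · refine (ContinuousLinearMap.le_opNorm _ _).trans ?_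
          gcongr
          exacts [hgd k x, hGB x]
        · rw [norm_mul]
          gcongr
          exacts [hHB x, hb' k x]
      · have h1 : x ∉ tsupport (g k) := fun h => hx (hk h)
        rw [Set.indicator_of_notMem hx, image_eq_zero_of_notMem_tsupport h1,
          Function.notMem_support.1 (fun h => h1 (support_fderiv_subset ℝ h))]
        simp
    · rw [integrable_indicator_iff hKc.isClosed.measurableSet]
      exact integrableOn_const hKc.measure_lt_top.ne
    · filter_upwards [hgdl] with x hx
      refine Tendsto.add ?_ ((hgl x).const_mul _)
      exact ((ContinuousLinearMap.apply ℝ ℝ (G x)).continuous.tendsto _).comp hx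
  refine ge_of_tendsto hlim ?_
  filter_upwards [hev] with k hk
  exact hweak _ (hgs k) (hKc.of_isClosed_subset (isClosed_tsupport _) hk) (hk.trans hδs)
    fun x => hg0 k x 0 hφ0

theorem energy_pointwise {lam Λ η e a ψ Ψ X Y Z m : ℝ} (hlam : 0 < lam) (hΛ : 0 ≤ Λ)
    (hη : 0 ≤ η) (hψ : 0 ≤ ψ) (he : 0 ≤ e)
    (ha : 0 ≤ a) (hΨ : ψ ≤ Ψ) (hΨm : Ψ ≤ (1 + m) * ψ) (hX : X ≤ e * (Λ * (a + 1)))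
    (hY : Y ≤ -(lam * a ^ 2 - Λ * a)) (hZ : Z ≤ Λ * (a + 1)) :
    ψ * (2 * η * X) + η ^ 2 * (Ψ * Y) + Z * (η ^ 2 * ψ) ≤
      -(lam / 2) * (η ^ 2 * ψ * a ^ 2) +
        (4 * Λ ^ 2 / lam + 2 * Λ) * (1 + m) * ((η ^ 2 + e ^ 2) * ψ) := by
  have hΨ0 : 0 ≤ Ψ := hψ.trans hΨ
  have h1 : 2 * η * (e * (Λ * (a + 1))) ≤
      lam / 4 * (η ^ 2 * a ^ 2) + 4 * Λ ^ 2 / lam * e ^ 2 + Λ * (η ^ 2 + e ^ 2) := by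
    have k1 : 2 * (η * a) * (Λ * e) ≤ lam / 4 * (η * a) ^ 2 + 4 * (Λ * e) ^ 2 / lam := by
      have : lam / 4 * (η * a) ^ 2 + 4 * (Λ * e) ^ 2 / lam - 2 * (η * a) * (Λ * e) =
        (lam * (η * a) - 4 * (Λ * e)) ^ 2 / (4 * lam) := by field_simp; ring
      have : 0 ≤ (lam * (η * a) - 4 * (Λ * e)) ^ 2 / (4 * lam) := by positivity
      linarith
    have k2 : 0 ≤ Λ * (η - e) ^ 2 := by positivity
    have k3 : 4 * (Λ * e) ^ 2 / lam = 4 * Λ ^ 2 / lam * e ^ 2 := by ring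
    nlinarith
  have h2 : 2 * (Λ * a) ≤ lam / 4 * a ^ 2 + 4 * Λ ^ 2 / lam := by
    have : lam / 4 * a ^ 2 + 4 * Λ ^ 2 / lam - 2 * (Λ * a) =
      (lam * a - 4 * Λ) ^ 2 / (4 * lam) := by field_simp; ring
    have : 0 ≤ (lam * a - 4 * Λ) ^ 2 / (4 * lam) := by positivity
    linarith
  calc ψ * (2 * η * X) + η ^ 2 * (Ψ * Y) + Z * (η ^ 2 * ψ)
      ≤ ψ * (2 * η * (e * (Λ * (a + 1)))) + η ^ 2 * (Ψ * -(lam * a ^ 2 - Λ * a)) +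
        Λ * (a + 1) * (η ^ 2 * ψ) := by gcongr
    _ ≤ Ψ * (2 * η * (e * (Λ * (a + 1)))) + η ^ 2 * (Ψ * -(lam * a ^ 2 - Λ * a)) +
        Λ * (a + 1) * (η ^ 2 * Ψ) := by gcongr
    _ = Ψ * (2 * η * (e * (Λ * (a + 1))) + η ^ 2 * (2 * (Λ * a)) - lam * (η ^ 2 * a ^ 2) +
        Λ * η ^ 2) := by ring
    _ ≤ Ψ * (lam / 4 * (η ^ 2 * a ^ 2) + 4 * Λ ^ 2 / lam * e ^ 2 + Λ * (η ^ 2 + e ^ 2) +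
        η ^ 2 * (lam / 4 * a ^ 2 + 4 * Λ ^ 2 / lam) - lam * (η ^ 2 * a ^ 2) +
        Λ * η ^ 2) := by gcongr
    _ ≤ Ψ * (-(lam / 2) * (η ^ 2 * a ^ 2) + (4 * Λ ^ 2 / lam + 2 * Λ) * (η ^ 2 + e ^ 2)) := by
        refine mul_le_mul_of_nonneg_left ?_ hΨ0
        nlinarith [mul_nonneg hΛ (sq_nonneg e)]
    _ = -(lam / 2) * (η ^ 2 * Ψ * a ^ 2) +
        (4 * Λ ^ 2 / lam + 2 * Λ) * ((η ^ 2 + e ^ 2) * Ψ) := by ring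
    _ ≤ -(lam / 2) * (η ^ 2 * ψ * a ^ 2) +
        (4 * Λ ^ 2 / lam + 2 * Λ) * ((η ^ 2 + e ^ 2) * ((1 + m) * ψ)) := by
        refine add_le_add ?_ (by gcongr)
        rw [neg_mul, neg_mul, neg_le_neg_iff]
        gcongr
    _ = _ := by ring

theorem logEnergyBound_of_integral_nonneg {s : Set E} {G : E → E} {H : E → ℝ}
    (hG : AEStronglyMeasurable G μ) (hH : AEStronglyMeasurable H μ) {B : ℝ}
    (hGB : ∀ x, ‖G x‖ ≤ B) (hHB : ∀ x, ‖H x‖ ≤ B)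
    (hweak : ∀ (φ : E → ℝ) (L : ℝ≥0), LipschitzWith L φ → HasCompactSupport φ → tsupport φ ⊆ s →
      (∀ x, 0 ≤ φ x) → 0 ≤ ∫ x, (fderiv ℝ φ x (G x) + H x * φ x) ∂μ)
    {f : E → ℝ} {L : ℝ≥0} (hf : LipschitzWith L f) {T : ℝ} (hfT : ∀ x, f x ∈ Set.Icc 1 T)
    {k lam Λ : ℝ} (hk : 0 < k) (hlam : 0 < lam) (hΛ : 0 ≤ Λ)
    (hGf : ∀ᵐ x ∂μ, x ∈ s → k * Real.exp (f x) * ‖G x‖ ≤ Λ * (‖fderiv ℝ f x‖ + 1))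
    (hell : ∀ᵐ x ∂μ, x ∈ s → k * Real.exp (f x) * fderiv ℝ f x (G x) ≤
      -(lam * ‖fderiv ℝ f x‖ ^ 2 - Λ * ‖fderiv ℝ f x‖))
    (hHf : ∀ᵐ x ∂μ, x ∈ s → k * Real.exp (f x) * |H x| ≤ Λ * (‖fderiv ℝ f x‖ + 1)) :
    LogEnergyBound μ s ((2 / lam) * (4 * Λ ^ 2 / lam + 2 * Λ)).toNNReal f := by
  intro m hm η Lη hηL hηc hηs hη0 hη1
  have hf0 : ∀ x, 0 < f x := fun x => zero_lt_one.trans_le (hfT x).1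
  have hfm0 : ∀ x, 0 ≤ f x ^ m := fun x => Real.rpow_nonneg (hf0 x).le m
  have hfmT : ∀ x, f x ^ m ≤ T ^ m := fun x => Real.rpow_le_rpow (hf0 x).le (hfT x).2 hm
  have habs : ∀ x, |η x| ≤ (1 : ℝ≥0) := fun x => by
    rw [abs_of_nonneg (hη0 x)]; exact hη1 x
  have hη2 := hηL.exists_mul_of_bounded hηL habs habs
  obtain ⟨K, hK⟩ := hf.exists_comp_contDiffOn hfT (θ := fun s => s ^ m * Real.exp s)
    ((contDiffOn_id.rpow_const_of_ne fun x hx => (zero_lt_one.trans_le hx.1).ne').mul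
      Real.contDiff_exp.contDiffOn)
  set φ : E → ℝ := fun x => η x ^ 2 * (f x ^ m * Real.exp (f x)) with hφ
  have hφL : ∃ L', LipschitzWith L' φ := by
    have := hη2.exists_mul_of_bounded hK (a := 1) (b := (T ^ m * Real.exp T).toNNReal)
      (fun x => ?_) (fun x => ?_)
    · exact ⟨_, by simpa only [hφ, sq] using this⟩
    · rw [abs_mul]; exact mul_le_one₀ (habs x) (abs_nonneg _) (habs x)
    · rw [abs_of_nonneg (mul_nonneg (hfm0 x) (Real.exp_pos _).le)]
      refine le_trans ?_ (Real.le_coe_toNNReal _)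
      exact mul_le_mul (hfmT x) (Real.exp_le_exp.2 (hfT x).2) (Real.exp_pos _).le
        ((hfm0 x).trans (hfmT x))
  obtain ⟨L', hφL⟩ := hφL
  have hφη : ∀ x, η x = 0 → φ x = 0 := fun x hx => by simp [hφ, hx]
  have hφs : tsupport φ ⊆ tsupport η :=
    closure_mono fun x hx => fun h => hx (hφη x h)
  have hφc : HasCompactSupport φ := hηc.of_isClosed_subset (isClosed_tsupport _) hφs
  have hφ0 : ∀ x, 0 ≤ φ x := fun x => by have := hfm0 x; positivity
  have hI := hweak φ L' hφL hφc (hφs.trans hηs) hφ0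
  have hout : ∀ x, x ∉ tsupport η → η x = 0 ∧ fderiv ℝ η x = 0 := fun x hx =>
    ⟨image_eq_zero_of_notMem_tsupport hx,
      Function.notMem_support.1 (fun h => hx (support_fderiv_subset ℝ h))⟩
  have hoφ : ∀ x, x ∉ tsupport η → φ x = 0 ∧ fderiv ℝ φ x = 0 := fun x hx =>
    ⟨image_eq_zero_of_notMem_tsupport fun h => hx (hφs h),
      Function.notMem_support.1 (fun h => hx (hφs (support_fderiv_subset ℝ h)))⟩
  have hfmeas := hf.continuous.measurable
  have hηmeas := hηL.continuous.measurable
  have hfd := (measurable_fderiv ℝ f).norm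
  have hηd := (measurable_fderiv ℝ η).norm
  have hLf : ∀ x, ‖fderiv ℝ f x‖ ≤ L := fun x => norm_fderiv_le_of_lipschitz ℝ hf
  have hLη : ∀ x, ‖fderiv ℝ η x‖ ≤ Lη := fun x => norm_fderiv_le_of_lipschitz ℝ hηL
  have hi1 : Integrable (fun x => η x ^ 2 * f x ^ m * ‖fderiv ℝ f x‖ ^ 2) μ := by
    refine integrable_of_norm_le_of_support_subset
      (Measurable.aestronglyMeasurable (by fun_prop)) hηc (fun x hx => ?_)
      (B := T ^ m * L ^ 2) fun x => ?_
    · by_contra h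
      simp [(hout x h).1] at hx
    · have := hfm0 x
      rw [Real.norm_of_nonneg (by positivity)]
      have hη2x := pow_le_one₀ (n := 2) (hη0 x) (hη1 x)
      exact mul_le_mul ((mul_le_of_le_one_left this hη2x).trans (hfmT x))
        (pow_le_pow_left₀ (norm_nonneg _) (hLf x) 2) (by positivity) (this.trans (hfmT x))
  have hi2 : Integrable (fun x => (η x ^ 2 + ‖fderiv ℝ η x‖ ^ 2) * f x ^ m) μ := by
    refine integrable_of_norm_le_of_support_subset
      (Measurable.aestronglyMeasurable (by fun_prop)) hηc (fun x hx => ?_)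
      (B := (1 + Lη ^ 2) * T ^ m) fun x => ?_
    · by_contra h
      simp [(hout x h).1, (hout x h).2] at hx
    · have := hfm0 x
      rw [Real.norm_of_nonneg (by positivity)]
      exact mul_le_mul (add_le_add (pow_le_one₀ (hη0 x) (hη1 x))
        (pow_le_pow_left₀ (norm_nonneg _) (hLη x) 2)) (hfmT x) this (by positivity)
  have hi3 := integrable_fderiv_apply_add hG hH hGB hHB hφL hφc
  set C : ℝ := 4 * Λ ^ 2 / lam + 2 * Λ with hC
  have hC0 : 0 ≤ C := by positivity
  have hpt : ∀ᵐ x ∂μ, k * (fderiv ℝ φ x (G x) + H x * φ x) ≤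
      -(lam / 2) * (η x ^ 2 * f x ^ m * ‖fderiv ℝ f x‖ ^ 2) +
        C * (1 + m) * ((η x ^ 2 + ‖fderiv ℝ η x‖ ^ 2) * f x ^ m) := by
    filter_upwards [hGf, hell, hHf, hf.ae_differentiableAt (μ := μ),
      hηL.ae_differentiableAt (μ := μ)] with x h1 h2 h3 h4 h5
    by_cases hx : x ∈ tsupport η
    · specialize h1 (hηs hx)
      specialize h2 (hηs hx)
      specialize h3 (hηs hx)
      have hd := (h5.hasFDerivAt.pow 2).mul
        ((h4.hasFDerivAt.rpow_const (p := m) (Or.inl (hf0 x).ne')).mul h4.hasFDerivAt.exp)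
      have hd' : fderiv ℝ φ x = _ := hd.fderiv
      have e0 : k * (fderiv ℝ φ x (G x) + H x * φ x) =
          f x ^ m * (2 * η x * (k * Real.exp (f x) * fderiv ℝ η x (G x))) +
          η x ^ 2 * ((f x ^ m + m * f x ^ (m - 1)) *
            (k * Real.exp (f x) * fderiv ℝ f x (G x))) +
          (k * Real.exp (f x) * H x) * (η x ^ 2 * f x ^ m) := by
        rw [hd']
        simp [hφ]
        ring
      rw [e0]
      have hkE : 0 < k * Real.exp (f x) := by positivity
      have hm1 : f x ^ (m - 1) ≤ f x ^ m :=
        Real.rpow_le_rpow_of_exponent_le (hfT x).1 (by linarith)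
      have hm0 : 0 ≤ f x ^ (m - 1) := Real.rpow_nonneg (hf0 x).le _
      refine energy_pointwise hlam hΛ (hη0 x) (hfm0 x) (norm_nonneg _) (norm_nonneg _)
        ?_ ?_ ?_ h2 ?_
      · nlinarith
      · nlinarith
      · calc k * Real.exp (f x) * fderiv ℝ η x (G x)
            ≤ k * Real.exp (f x) * (‖fderiv ℝ η x‖ * ‖G x‖) := by
              gcongr
              exact (Real.le_norm_self _).trans (ContinuousLinearMap.le_opNorm _ _)
          _ = ‖fderiv ℝ η x‖ * (k * Real.exp (f x) * ‖G x‖) := by ring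
          _ ≤ _ := by gcongr
      · refine le_trans ?_ h3
        gcongr
        exact le_abs_self _
    · simp [(hout x hx).1, (hout x hx).2, (hoφ x hx).1, (hoφ x hx).2]
  have hint := integral_mono_ae (hi3.const_mul k)
    ((hi1.const_mul (-(lam / 2))).add (hi2.const_mul (C * (1 + m)))) hpt
  have hint' : 0 ≤ -(lam / 2) * (∫ x, η x ^ 2 * f x ^ m * ‖fderiv ℝ f x‖ ^ 2 ∂μ) +
      C * (1 + m) * ∫ x, (η x ^ 2 + ‖fderiv ℝ η x‖ ^ 2) * f x ^ m ∂μ := by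
    rw [← integral_const_mul, ← integral_const_mul, ← integral_add (hi1.const_mul (-(lam / 2)))
      (hi2.const_mul (C * (1 + m)))]
    refine le_trans ?_ hint
    rw [integral_const_mul]
    positivity
  rw [← ofReal_integral_eq_lintegral_ofReal hi1 (Eventually.of_forall fun x => by
      have := hfm0 x
      positivity),
    ← ofReal_integral_eq_lintegral_ofReal hi2 (Eventually.of_forall fun x => by
      have := hfm0 x
      positivity), Real.coe_toNNReal _ (by positivity), ← ENNReal.ofReal_mul (by positivity)]
  refine ENNReal.ofReal_le_ofReal ?_
  have h6 : 2 / lam * C * (1 + m) * (∫ x, (η x ^ 2 + ‖fderiv ℝ η x‖ ^ 2) * f x ^ m ∂μ) =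
    2 / lam * (C * (1 + m) * ∫ x, (η x ^ 2 + ‖fderiv ℝ η x‖ ^ 2) * f x ^ m ∂μ) := by ring
  rw [h6, div_mul_eq_mul_div, le_div_iff₀ hlam]
  linarith

end Energy

section Vanishing

variable {E : Type*} [NormedAddCommGroup E] [NormedSpace ℝ E] [FiniteDimensional ℝ E]
  [Nontrivial E] [MeasurableSpace E] [BorelSpace E] (μ : Measure E) [μ.IsAddHaarMeasure]

/-- The strong minimum principle for nonnegative Lipschitz supersolutions of a linear equation
in divergence form. -/
theorem eq_zero_of_weak_supersolution {x₁ : E} {R : ℝ} (hR : 0 < R) {u : E → ℝ} {L : ℝ≥0}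
    (hu : LipschitzWith L u) (hu0 : ∀ x, 0 ≤ u x) {K : ℝ} (huK : ∀ x, u x ≤ K) (hux : u x₁ = 0)
    {G : E → E} {H : E → ℝ} (hG : AEStronglyMeasurable G μ) (hH : AEStronglyMeasurable H μ) {B : ℝ}
    (hGB : ∀ x, ‖G x‖ ≤ B) (hHB : ∀ x, ‖H x‖ ≤ B)
    (hweak : ∀ φ : E → ℝ, ContDiff ℝ (⊤ : ℕ∞) φ → HasCompactSupport φ →
      tsupport φ ⊆ ball x₁ (4 * R) → (∀ x, 0 ≤ φ x) →
        0 ≤ ∫ x, (fderiv ℝ φ x (G x) + H x * φ x) ∂μ)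
    {lam Λ : ℝ} (hlam : 0 < lam) (hΛ : 0 ≤ Λ)
    (hGu : ∀ᵐ x ∂μ, x ∈ ball x₁ (4 * R) → ‖G x‖ ≤ Λ * (‖fderiv ℝ u x‖ + u x))
    (hell : ∀ᵐ x ∂μ, x ∈ ball x₁ (4 * R) →
      lam * ‖fderiv ℝ u x‖ ^ 2 - Λ * (u x * ‖fderiv ℝ u x‖) ≤ fderiv ℝ u x (G x))
    (hHu : ∀ᵐ x ∂μ, x ∈ ball x₁ (4 * R) → |H x| ≤ Λ * (‖fderiv ℝ u x‖ + u x))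
    {y : E} (hy : y ∈ ball x₁ (2 * R)) : u y = 0 := by
  by_contra hne
  have hy0 : 0 < u y := (hu0 y).lt_of_ne (Ne.symm hne)
  have hK0 : 0 ≤ K := (hu0 y).trans (huK y)
  have hev : ∀ᶠ x in 𝓝 y, u y / 2 < u x :=
    hu.continuous.continuousAt.eventually (lt_mem_nhds (half_lt_self hy0))
  obtain ⟨δ, hδ, hδu⟩ := Metric.eventually_nhds_iff_ball.1
    (hev.and (isOpen_ball.mem_nhds hy))
  set K' : ℝ := Real.exp 1 * (K + 1) with hK'
  have hK'0 : 0 < K' := by positivity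
  obtain ⟨N, hN⟩ := LogEnergyBound.exists_le μ ((2 / lam) * (4 * Λ ^ 2 / lam + 2 * Λ)).toNNReal hR
    x₁ (A := ball y δ) (fun x hx => ball_subset_closedBall (hδu x hx).2) measurableSet_ball
    (measure_ball_pos μ y hδ).ne' (Real.log (K' / (u y / 2))).toNNReal
  set ε : ℝ := min 1 (K' * Real.exp (-(N + 1))) with hε
  have hε0 : 0 < ε := lt_min one_pos (by positivity)
  have hpos : ∀ x, 0 < u x + ε := fun x => by linarith [hu0 x]
  have hquot : ∀ x, 0 < K' / (u x + ε) := fun x => div_pos hK'0 (hpos x)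
  set f : E → ℝ := fun x => Real.log (K' / (u x + ε)) with hf
  have hexp : ∀ x, 1 / K' * Real.exp (f x) = (u x + ε)⁻¹ := fun x => by
    simp only [hf]
    rw [Real.exp_log (hquot x)]
    field_simp
  obtain ⟨Lf, hfL⟩ := hu.exists_comp_contDiffOn (fun x => ⟨hu0 x, huK x⟩)
    (θ := fun s => Real.log (K' / (s + ε))) (by
      have h1 : ∀ s ∈ Set.Icc 0 K, s + ε ≠ 0 := fun s hs => by linarith [hs.1]
      refine ContDiffOn.log (contDiffOn_const.div (contDiffOn_id.add contDiffOn_const) h1)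
        fun s hs => (div_ne_zero hK'0.ne' (h1 s hs)))
  have hfT : ∀ x, f x ∈ Set.Icc 1 (Real.log (K' / ε)) := fun x => by
    constructor
    · rw [Real.le_log_iff_exp_le (hquot x), le_div_iff₀ (hpos x)]
      have h1 : ε ≤ 1 := min_le_left _ _
      exact mul_le_mul_of_nonneg_left (add_le_add (huK x) h1) (Real.exp_pos 1).le
    · refine Real.log_le_log (hquot x) ?_
      gcongr
      linarith [hu0 x]
  have hfA : ∀ z ∈ ball y δ, f z ≤ (Real.log (K' / (u y / 2))).toNNReal := fun z hz => by
    refine le_trans (Real.log_le_log (hquot z) ?_) (Real.le_coe_toNNReal _)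
    gcongr
    linarith [(hδu z hz).1]
  have hfd : ∀ᵐ x ∂μ, fderiv ℝ f x = -((u x + ε)⁻¹ • fderiv ℝ u x) := by
    filter_upwards [hu.ae_differentiableAt (μ := μ)] with x hx
    have h1 : HasFDerivAt (fun z => Real.log K' - Real.log (u z + ε))
        (-((u x + ε)⁻¹ • fderiv ℝ u x)) x :=
      ((hx.hasFDerivAt.add_const ε).log (hpos x).ne').const_sub _
    have h2 : f = fun z => Real.log K' - Real.log (u z + ε) := by
      funext z
      exact Real.log_div hK'0.ne' (hpos z).ne'
    rw [h2]
    exact h1.fderiv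
  have hfdn : ∀ᵐ x ∂μ, ‖fderiv ℝ f x‖ = (u x + ε)⁻¹ * ‖fderiv ℝ u x‖ := by
    filter_upwards [hfd] with x hx
    rw [hx, norm_neg, norm_smul, Real.norm_of_nonneg (inv_nonneg.2 (hpos x).le)]
  have hlin : ∀ x t a, 0 ≤ a → t ≤ Λ * (a + u x) →
      (u x + ε)⁻¹ * t ≤ Λ * ((u x + ε)⁻¹ * a + 1) := fun x t a ha h => by
    have hp := hpos x
    rw [inv_mul_le_iff₀ hp]
    have : (u x + ε) * (Λ * ((u x + ε)⁻¹ * a + 1)) = Λ * (a + (u x + ε)) := by field_simp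
    rw [this]
    refine h.trans ?_
    gcongr
    linarith
  have hE := logEnergyBound_of_integral_nonneg μ (s := ball x₁ (4 * R)) hG hH hGB hHB
    (fun φ L' h1 h2 h3 h4 => integral_nonneg_of_lipschitz μ isOpen_ball hG hH hGB hHB hweak
      h1 h2 h3 h4) hfL hfT (k := 1 / K') (by positivity) hlam hΛ
    (by
      filter_upwards [hGu, hfdn] with x h1 h2 hx
      rw [hexp, h2]
      exact hlin x _ _ (norm_nonneg _) (h1 hx))
    (by
      filter_upwards [hell, hfd, hfdn] with x h1 h2 h3 hx
      rw [hexp, h3, h2]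
      have hp := hpos x
      have h4 := h1 hx
      have h5 : u x * ‖fderiv ℝ u x‖ ≤ (u x + ε) * ‖fderiv ℝ u x‖ := by
        gcongr
        linarith
      have h6 : lam * ‖fderiv ℝ u x‖ ^ 2 - Λ * ((u x + ε) * ‖fderiv ℝ u x‖) ≤
          fderiv ℝ u x (G x) := by
        have := mul_le_mul_of_nonneg_left h5 hΛ
        linarith
      have h7 := mul_le_mul_of_nonneg_left h6 (by positivity : 0 ≤ ((u x + ε)⁻¹) ^ 2)
      have h8 : ((u x + ε)⁻¹) ^ 2 * (Λ * ((u x + ε) * ‖fderiv ℝ u x‖)) =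
          Λ * ((u x + ε)⁻¹ * ‖fderiv ℝ u x‖) := by field_simp
      simp only [neg_apply, smul_apply, smul_eq_mul]
      linarith)
    (by
      filter_upwards [hHu, hfdn] with x h1 h2 hx
      rw [hexp, h2]
      exact hlin x _ _ (norm_nonneg _) (h1 hx))
  have hfin := hN f Lf _ hfL hfT hE hfA
  have : N + 1 ≤ f x₁ := by
    rw [Real.le_log_iff_exp_le (hquot x₁), hux, zero_add, le_div_iff₀ hε0]
    calc Real.exp (N + 1) * ε ≤ Real.exp (N + 1) * (K' * Real.exp (-(N + 1))) := by
          gcongr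
          exact min_le_right _ _
      _ = K' := by rw [Real.exp_neg]; field_simp
  linarith

end Vanishing

section Comparison

theorem measurable_indicator_comp_of_continuousOn {X Y V : Type*} [MeasurableSpace X]
    [TopologicalSpace Y] [MeasurableSpace Y] [OpensMeasurableSpace Y] [TopologicalSpace V]
    [MeasurableSpace V] [BorelSpace V] [Zero V] {Φ : Y → V} {S : Set Y} (hΦ : ContinuousOn Φ S)
    (hS : MeasurableSet S) {γ : X → Y} (hγ : Measurable γ) {Q : Set X} (hQ : MeasurableSet Q)
    (hQS : ∀ x ∈ Q, γ x ∈ S) : Measurable (Q.indicator fun x => Φ (γ x)) := by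
  classical
  have h1 : Measurable (S.piecewise Φ fun _ => 0) := hΦ.measurable_piecewise continuousOn_const hS
  have h2 : (Q.indicator fun x => Φ (γ x)) =
      Q.indicator fun x => (S.piecewise Φ fun _ => 0) (γ x) := by
    refine Set.indicator_congr fun x hx => ?_
    rw [Set.piecewise_eq_of_mem _ _ _ (hQS x hx)]
  rw [h2]
  exact (h1.comp hγ).indicator hQ

variable {E : Type*} [NormedAddCommGroup E] [InnerProductSpace ℝ E]

theorem inner_sub_ge_of_fderiv {F : E → E} (hF : Differentiable ℝ F) {M lam : ℝ}
    (hell : ∀ p, ‖p‖ ≤ M → ∀ ξ, lam * ‖ξ‖ ^ 2 ≤ ⟪fderiv ℝ F p ξ, ξ⟫_ℝ) {p p' : E}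
    (hp : ‖p‖ ≤ M) (hp' : ‖p'‖ ≤ M) : lam * ‖p - p'‖ ^ 2 ≤ ⟪F p - F p', p - p'⟫_ℝ := by
  set γ : ℝ → E := fun t => p' + t • (p - p') with hγ
  have hγd : ∀ t, HasDerivAt γ (p - p') t := fun t => by
    have h1 := ((hasDerivAt_id t).smul_const (p - p')).const_add p'
    rw [one_smul] at h1
    exact h1
  have hd : ∀ t, HasDerivAt (fun t => ⟪F (γ t), p - p'⟫_ℝ)
      ⟪fderiv ℝ F (γ t) (p - p'), p - p'⟫_ℝ t := fun t => by
    have := ((hF (γ t)).hasFDerivAt.comp_hasDerivAt t (hγd t)).inner ℝ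
      (hasDerivAt_const t (p - p'))
    simpa using this
  obtain ⟨t, ht, h⟩ := exists_hasDerivAt_eq_slope (fun t => ⟪F (γ t), p - p'⟫_ℝ) _ one_pos
    (fun t _ => (hd t).continuousAt.continuousWithinAt) (fun t _ => hd t)
  have hγt : ‖γ t‖ ≤ M := by
    have h1 : γ t ∈ closedBall (0 : E) M := by
      have h2 := (convex_closedBall (0 : E) M).add_smul_sub_mem (mem_closedBall_zero_iff.2 hp')
        (mem_closedBall_zero_iff.2 hp) ⟨ht.1.le, ht.2.le⟩
      exact h2
    exact mem_closedBall_zero_iff.1 h1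
  have h3 := hell (γ t) hγt (p - p')
  rw [h] at h3
  simpa [hγ, inner_sub_left] using h3

variable [FiniteDimensional ℝ E]

theorem norm_gradient (v : E → ℝ) (x : E) : ‖gradient v x‖ = ‖fderiv ℝ v x‖ :=
  LinearIsometryEquiv.norm_map _ _

variable [MeasurableSpace E] [BorelSpace E]

theorem measurable_gradient (v : E → ℝ) : Measurable (gradient v) :=
  (InnerProductSpace.toDual ℝ E).symm.continuous.measurable.comp (measurable_fderiv ℝ v)

variable [Nontrivial E] (μ : Measure E) [μ.IsAddHaarMeasure]

/-- A subsolution and a supersolution of a quasilinear elliptic equation that touch at a point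
agree near that point. -/
theorem eventually_eq_of_sub_of_super {s : Set E} (hs : IsOpen s)
    {F : E → ℝ → E → E} {F₀ : E → ℝ → E → ℝ}
    (hF : ContDiffOn ℝ 1 (fun q : E × ℝ × E => F q.1 q.2.1 q.2.2) (s ×ˢ Set.univ ×ˢ Set.univ))
    (hF₀ : ContDiffOn ℝ 1 (fun q : E × ℝ × E => F₀ q.1 q.2.1 q.2.2) (s ×ˢ Set.univ ×ˢ Set.univ))
    (hell : ∀ M : ℝ, 0 < M → ∃ lam : ℝ, 0 < lam ∧
      ∀ x ∈ s, ∀ z : ℝ, |z| ≤ M → ∀ p : E, ‖p‖ ≤ M →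
        ∀ ξ : E, lam * ‖ξ‖ ^ 2 ≤ ⟪fderiv ℝ (F x z) p ξ, ξ⟫_ℝ)
    {v w : E → ℝ} {Lv Lw : ℝ≥0} (hv : LipschitzWith Lv v) (hw : LipschitzWith Lw w)
    (hsub : ∀ φ : E → ℝ, ContDiff ℝ (⊤ : ℕ∞) φ → HasCompactSupport φ →
      tsupport φ ⊆ s → (∀ x, 0 ≤ φ x) →
      (∫ x in s, (⟪F x (v x) (gradient v x), gradient φ x⟫_ℝ +
          F₀ x (v x) (gradient v x) * φ x) ∂μ) ≤ 0)
    (hsup : ∀ φ : E → ℝ, ContDiff ℝ (⊤ : ℕ∞) φ → HasCompactSupport φ →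
      tsupport φ ⊆ s → (∀ x, 0 ≤ φ x) →
      0 ≤ ∫ x in s, (⟪F x (w x) (gradient w x), gradient φ x⟫_ℝ +
          F₀ x (w x) (gradient w x) * φ x) ∂μ)
    (hle : ∀ x ∈ s, v x ≤ w x) {x₁ : E} (hx₁ : x₁ ∈ s) (heq : v x₁ = w x₁) :
    ∀ᶠ y in 𝓝 x₁, v y = w y := by
  obtain ⟨ρ, hρ, hρs⟩ := nhds_basis_closedBall.mem_iff.1 (hs.mem_nhds hx₁)
  obtain ⟨R, hR, rfl⟩ : ∃ R : ℝ, 0 < R ∧ ρ = 4 * R := ⟨ρ / 4, by positivity, by ring⟩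
  have hQs : ball x₁ (4 * R) ⊆ s := ball_subset_closedBall.trans hρs
  have hQc := isCompact_closedBall x₁ (4 * R)
  obtain ⟨bv, hbv⟩ := hQc.exists_bound_of_continuousOn hv.continuous.continuousOn
  obtain ⟨bw, hbw⟩ := hQc.exists_bound_of_continuousOn hw.continuous.continuousOn
  obtain ⟨M, hM0, hbvM, hbwM, hLvM, hLwM⟩ :
      ∃ M : ℝ, 0 < M ∧ bv ≤ M ∧ bw ≤ M ∧ Lv ≤ M ∧ Lw ≤ M := by
    refine ⟨|bv| + |bw| + Lv + Lw + 1, by positivity, ?_, ?_, ?_, ?_⟩ <;>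
    linarith [le_abs_self bv, le_abs_self bw, abs_nonneg bv, abs_nonneg bw, Lv.2, Lw.2]
  set S : Set (E × ℝ × E) := closedBall x₁ (4 * R) ×ˢ Set.Icc (-M) M ×ˢ closedBall (0 : E) M
    with hS
  have hSs : S ⊆ s ×ˢ Set.univ ×ˢ Set.univ := fun q hq => ⟨hρs hq.1, trivial, trivial⟩
  have hSc : IsCompact S := hQc.prod (isCompact_Icc.prod (isCompact_closedBall _ _))
  have hSv : Convex ℝ S :=
    (convex_closedBall _ _).prod ((convex_Icc _ _).prod (convex_closedBall _ _))
  have hSm : MeasurableSet S := hSc.measurableSet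
  obtain ⟨lam, hlam, hlamF⟩ := hell M hM0
  obtain ⟨K₁, hK₁⟩ := (hF.mono hSs).exists_lipschitzOnWith one_ne_zero hSv hSc
  obtain ⟨K₂, hK₂⟩ := (hF₀.mono hSs).exists_lipschitzOnWith one_ne_zero hSv hSc
  obtain ⟨b₁, hb₁⟩ := hSc.exists_bound_of_continuousOn hK₁.continuousOn
  obtain ⟨b₂, hb₂⟩ := hSc.exists_bound_of_continuousOn hK₂.continuousOn
  have hmem : ∀ {a : E → ℝ} {La : ℝ≥0} {ba : ℝ}, LipschitzWith La a →
      (∀ x ∈ closedBall x₁ (4 * R), ‖a x‖ ≤ ba) → ba ≤ M → La ≤ M →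
      ∀ x ∈ ball x₁ (4 * R), |a x| ≤ M ∧ ‖gradient a x‖ ≤ M := fun ha hba hbM hLM x hx =>
    ⟨(hba x (ball_subset_closedBall hx)).trans hbM, by
      rw [norm_gradient]
      exact (norm_fderiv_le_of_lipschitz ℝ ha).trans hLM⟩
  have hmv := hmem hv hbv hbvM hLvM
  have hmw := hmem hw hbw hbwM hLwM
  set Q : Set E := ball x₁ (4 * R) with hQ
  have hγS : ∀ {a : E → ℝ}, (∀ x ∈ Q, |a x| ≤ M ∧ ‖gradient a x‖ ≤ M) →
      ∀ x ∈ Q, (x, a x, gradient a x) ∈ S := fun ha x hx =>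
    ⟨ball_subset_closedBall hx, abs_le.1 (ha x hx).1, mem_closedBall_zero_iff.2 (ha x hx).2⟩
  have hγm : ∀ {a : E → ℝ}, Continuous a → Measurable fun x => (x, a x, gradient a x) := fun ha =>
    measurable_id.prodMk (ha.measurable.prodMk (measurable_gradient _))
  set G : (E → ℝ) → E → E := fun a => Q.indicator fun x => F x (a x) (gradient a x) with hG
  set H : (E → ℝ) → E → ℝ := fun a => Q.indicator fun x => F₀ x (a x) (gradient a x) with hH
  have hGQ : ∀ a, ∀ x ∈ Q, G a x = F x (a x) (gradient a x) := fun a x hx =>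
    Set.indicator_of_mem hx _
  have hHQ : ∀ a, ∀ x ∈ Q, H a x = F₀ x (a x) (gradient a x) := fun a x hx =>
    Set.indicator_of_mem hx _
  have hGm : ∀ {a : E → ℝ}, Continuous a → (∀ x ∈ Q, |a x| ≤ M ∧ ‖gradient a x‖ ≤ M) →
      Measurable (G a) := fun ha hm =>
    measurable_indicator_comp_of_continuousOn hK₁.continuousOn hSm (hγm ha) measurableSet_ball
      (hγS hm)
  have hHm : ∀ {a : E → ℝ}, Continuous a → (∀ x ∈ Q, |a x| ≤ M ∧ ‖gradient a x‖ ≤ M) →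
      Measurable (H a) := fun ha hm =>
    measurable_indicator_comp_of_continuousOn hK₂.continuousOn hSm (hγm ha) measurableSet_ball
      (hγS hm)
  have hGB : ∀ {a : E → ℝ}, (∀ x ∈ Q, |a x| ≤ M ∧ ‖gradient a x‖ ≤ M) →
      ∀ x, ‖G a x‖ ≤ max b₁ 0 := fun {a} hm x => by
    by_cases hx : x ∈ Q
    · simpa [hG, hx] using Or.inl (hb₁ _ (hγS hm x hx))
    · simp [hG, hx]
  have hHB : ∀ {a : E → ℝ}, (∀ x ∈ Q, |a x| ≤ M ∧ ‖gradient a x‖ ≤ M) →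
      ∀ x, ‖H a x‖ ≤ max b₂ 0 := fun {a} hm x => by
    by_cases hx : x ∈ Q
    · simpa [hH, hx] using Or.inl (hb₂ _ (hγS hm x hx))
    · simp [hH, hx]
  have hint : ∀ (a : E → ℝ) (φ : E → ℝ), tsupport φ ⊆ Q →
      ∫ x in s, (⟪F x (a x) (gradient a x), gradient φ x⟫_ℝ +
        F₀ x (a x) (gradient a x) * φ x) ∂μ =
      ∫ x, (fderiv ℝ φ x (G a x) + H a x * φ x) ∂μ := by
    intro a φ hφ
    have h0 : ∀ x ∉ Q, fderiv ℝ φ x = 0 ∧ φ x = 0 := fun x hx =>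
      ⟨Function.notMem_support.1 fun h => hx (hφ (support_fderiv_subset ℝ h)),
        image_eq_zero_of_notMem_tsupport fun h => hx (hφ h)⟩
    refine Eq.trans ?_ (setIntegral_eq_integral_of_forall_compl_eq_zero (s := s) ?_)
    · refine setIntegral_congr_fun hs.measurableSet fun x _ => ?_
      rw [inner_gradient_right, conj_trivial]
      by_cases hx : x ∈ Q
      · rw [hGQ a x hx, hHQ a x hx]
      · simp [h0 x hx]
    · intro x hx
      have := h0 x fun h => hx (hQs h)
      simp [this]
  set u : E → ℝ := fun x => min (max (w x - v x) 0) (2 * M) with hu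
  have huL : LipschitzWith (Lw + Lv) u := ((hw.sub hv).max_const 0).min_const (2 * M)
  have hueq : ∀ x ∈ Q, u x = w x - v x := fun x hx => by
    have h1 := hle x (hQs hx)
    have h2 := abs_le.1 (hmv x hx).1
    have h3 := abs_le.1 (hmw x hx).1
    simp only [hu]
    rw [max_eq_left (by linarith), min_eq_left (by linarith)]
  have hu0 : ∀ x, 0 ≤ u x := fun x => le_min (le_max_right _ _) (by linarith)
  have hux : u x₁ = 0 := by
    rw [hueq x₁ (mem_ball_self (by linarith)), heq, sub_self]
  have hgrad : ∀ᵐ x ∂μ, x ∈ Q → gradient u x = gradient w x - gradient v x := by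
    filter_upwards [hv.ae_differentiableAt (μ := μ), hw.ae_differentiableAt (μ := μ)]
      with x h1 h2 hx
    have h3 : u =ᶠ[𝓝 x] w - v := by
      filter_upwards [isOpen_ball.mem_nhds hx] with y hy using hueq y hy
    rw [gradient, h3.fderiv_eq, fderiv_sub h2 h1, map_sub]
    rfl
  have hcl : ∀ x ∈ Q, ∀ {z z' : ℝ} {p p' : E}, |z| ≤ M → |z'| ≤ M → ‖p‖ ≤ M → ‖p'‖ ≤ M →
      ‖F x z p - F x z' p'‖ ≤ K₁ * (‖p - p'‖ + |z - z'|) ∧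
        |F₀ x z p - F₀ x z' p'| ≤ K₂ * (‖p - p'‖ + |z - z'|) := by
    intro x hx z z' p p' hz hz' hp hp'
    have hq : (x, z, p) ∈ S :=
      ⟨ball_subset_closedBall hx, abs_le.1 hz, mem_closedBall_zero_iff.2 hp⟩
    have hq' : (x, z', p') ∈ S :=
      ⟨ball_subset_closedBall hx, abs_le.1 hz', mem_closedBall_zero_iff.2 hp'⟩
    have hd : dist (x, z, p) (x, z', p') ≤ ‖p - p'‖ + |z - z'| := by
      rw [Prod.dist_eq, Prod.dist_eq, dist_self, dist_eq_norm, dist_eq_norm, Real.norm_eq_abs]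
      have := norm_nonneg (p - p')
      have := abs_nonneg (z - z')
      refine max_le (by positivity) (max_le (by linarith) (by linarith))
    have h1 := hK₁.dist_le_mul _ hq _ hq'
    have h2 := hK₂.dist_le_mul _ hq _ hq'
    rw [dist_eq_norm] at h1 h2
    exact ⟨h1.trans (mul_le_mul_of_nonneg_left hd K₁.2),
      h2.trans (mul_le_mul_of_nonneg_left hd K₂.2)⟩
  have hFd : ∀ x ∈ Q, ∀ z, Differentiable ℝ (F x z) := fun x hx z p => by
    have h1 : DifferentiableAt ℝ (fun q : E × ℝ × E => F q.1 q.2.1 q.2.2) (x, z, p) :=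
      (hF.contDiffAt ((hs.prod (isOpen_univ.prod isOpen_univ)).mem_nhds
        ⟨hQs hx, trivial, trivial⟩)).differentiableAt one_ne_zero
    exact h1.comp (f := fun p => (x, z, p)) p (by fun_prop)
  have hQn : ∀ x ∈ Q, |w x - v x| = u x := fun x hx => by
    rw [← hueq x hx, abs_of_nonneg (hu0 x)]
  have hΛ₁ : (K₁ : ℝ) ≤ K₁ + K₂ := le_add_of_nonneg_right K₂.2
  have hΛ₂ : (K₂ : ℝ) ≤ K₁ + K₂ := le_add_of_nonneg_left K₁.2
  have hmain : ∀ y ∈ ball x₁ (2 * R), u y = 0 := fun y hy => by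
    refine eq_zero_of_weak_supersolution μ hR huL hu0 (fun x => min_le_right _ _) hux
      (G := G w - G v) (H := H w - H v) (B := max b₁ 0 + max b₁ 0 + (max b₂ 0 + max b₂ 0))
      (Λ := K₁ + K₂) ((hGm hw.continuous hmw).sub (hGm hv.continuous hmv)).aestronglyMeasurable
      ((hHm hw.continuous hmw).sub (hHm hv.continuous hmv)).aestronglyMeasurable ?_ ?_ ?_ hlam
      (by positivity) ?_ ?_ ?_ hy
    · intro x
      refine (norm_sub_le _ _).trans ((add_le_add (hGB hmw x) (hGB hmv x)).trans ?_)
      exact le_add_of_nonneg_right (by positivity)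
    · intro x
      refine (norm_sub_le _ _).trans ((add_le_add (hHB hmw x) (hHB hmv x)).trans ?_)
      exact le_add_of_nonneg_left (by positivity)
    · intro φ hφ hφc hφQ hφ0
      have h1 := hsub φ hφ hφc (hφQ.trans hQs) hφ0
      have h2 := hsup φ hφ hφc (hφQ.trans hQs) hφ0
      rw [hint _ _ hφQ] at h1 h2
      obtain ⟨L, hL⟩ := hφ.lipschitzWith_of_hasCompactSupport hφc (by simp)
      have h3 := integrable_fderiv_apply_add (μ := μ)
        (hGm hv.continuous hmv).aestronglyMeasurable (hHm hv.continuous hmv).aestronglyMeasurable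
        (fun x => (hGB hmv x).trans (le_max_left _ (max b₂ 0)))
        (fun x => (hHB hmv x).trans (le_max_right (max b₁ 0) _)) hL hφc
      have h4 := integrable_fderiv_apply_add (μ := μ)
        (hGm hw.continuous hmw).aestronglyMeasurable (hHm hw.continuous hmw).aestronglyMeasurable
        (fun x => (hGB hmw x).trans (le_max_left _ (max b₂ 0)))
        (fun x => (hHB hmw x).trans (le_max_right (max b₁ 0) _)) hL hφc
      calc (0 : ℝ) ≤ _ := sub_nonneg.2 (h1.trans h2)
        _ = _ := (integral_sub h4 h3).symm
        _ = _ := by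
          congr 1
          funext x
          simp only [Pi.sub_apply, map_sub]
          ring
    · filter_upwards [hgrad] with x hx hxQ
      have h1 := (hcl x hxQ (hmw x hxQ).1 (hmv x hxQ).1 (hmw x hxQ).2 (hmv x hxQ).2).1
      rw [← hx hxQ, hQn x hxQ, norm_gradient] at h1
      rw [Pi.sub_apply, hGQ _ x hxQ, hGQ _ x hxQ]
      exact h1.trans (mul_le_mul_of_nonneg_right hΛ₁ (add_nonneg (norm_nonneg _) (hu0 x)))
    · filter_upwards [hgrad] with x hx hxQ
      have h1 := inner_sub_ge_of_fderiv (hFd x hxQ (w x))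
        (hlamF x (hQs hxQ) (w x) (hmw x hxQ).1) (hmw x hxQ).2 (hmv x hxQ).2
      have h2 := (hcl x hxQ (hmw x hxQ).1 (hmv x hxQ).1 (hmv x hxQ).2 (hmv x hxQ).2).1
      rw [sub_self, norm_zero, zero_add, hQn x hxQ] at h2
      rw [← hx hxQ, norm_gradient] at h1
      have h3 := neg_le_of_abs_le (abs_real_inner_le_norm
        (F x (w x) (gradient v x) - F x (v x) (gradient v x)) (gradient u x))
      have h4 : ‖F x (w x) (gradient v x) - F x (v x) (gradient v x)‖ * ‖gradient u x‖ ≤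
          (K₁ + K₂) * (u x * ‖fderiv ℝ u x‖) := by
        rw [norm_gradient, ← mul_assoc]
        exact mul_le_mul_of_nonneg_right
          (h2.trans (mul_le_mul_of_nonneg_right hΛ₁ (hu0 x))) (norm_nonneg _)
      have h5 : fderiv ℝ u x ((G w - G v) x) =
          ⟪F x (w x) (gradient w x) - F x (w x) (gradient v x), gradient u x⟫_ℝ +
          ⟪F x (w x) (gradient v x) - F x (v x) (gradient v x), gradient u x⟫_ℝ := by
        rw [← inner_add_left, sub_add_sub_cancel]
        simp only [Pi.sub_apply, hGQ _ x hxQ, inner_gradient_right]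
        simp
      rw [h5]
      linarith
    · filter_upwards [hgrad] with x hx hxQ
      have h1 := (hcl x hxQ (hmw x hxQ).1 (hmv x hxQ).1 (hmw x hxQ).2 (hmv x hxQ).2).2
      rw [← hx hxQ, hQn x hxQ, norm_gradient] at h1
      rw [Pi.sub_apply, hHQ _ x hxQ, hHQ _ x hxQ]
      exact h1.trans (mul_le_mul_of_nonneg_right hΛ₂ (add_nonneg (norm_nonneg _) (hu0 x)))
  filter_upwards [ball_mem_nhds x₁ (show 0 < 2 * R by positivity)] with y hy
  have h1 := hmain y hy
  rw [hueq y (ball_subset_ball (by linarith) hy)] at h1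
  linarith

end Comparison

open TOP in
/-- Corollary: strong comparison principle / Harnack consequence.
If `v` is a Lipschitz weak subsolution and `w` a Lipschitz weak supersolution of
`div F(x, u, ∇u) = F₀(x, u, ∇u)` in `B_{3r}(x₀)`, with `F, F₀` of class `C¹` and
elliptic there, `v ≤ w` in `B_{3r}(x₀)` and `v(x₀) = w(x₀)`, then `v ≡ w` in `B_r(x₀)`. -/
theorem comparison_principle {n : ℕ} (x₀ : Eucl n) (r : ℝ) (hr : 0 < r)
    (F : Eucl n → ℝ → Eucl n → Eucl n) (F₀ : Eucl n → ℝ → Eucl n → ℝ)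
    (hF : ContDiffOn ℝ 1 (fun q : Eucl n × ℝ × Eucl n => F q.1 q.2.1 q.2.2)
      (Metric.ball x₀ (3 * r) ×ˢ (Set.univ : Set ℝ) ×ˢ (Set.univ : Set (Eucl n))))
    (hF₀ : ContDiffOn ℝ 1 (fun q : Eucl n × ℝ × Eucl n => F₀ q.1 q.2.1 q.2.2)
      (Metric.ball x₀ (3 * r) ×ˢ (Set.univ : Set ℝ) ×ˢ (Set.univ : Set (Eucl n))))
    (hell : ∀ M : ℝ, 0 < M → ∃ lam : ℝ, 0 < lam ∧
      ∀ x ∈ Metric.ball x₀ (3 * r), ∀ z : ℝ, |z| ≤ M → ∀ p : Eucl n, ‖p‖ ≤ M →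
        ∀ ξ : Eucl n, lam * ‖ξ‖ ^ 2 ≤ ⟪fderiv ℝ (F x z) p ξ, ξ⟫_ℝ)
    (v w : Eucl n → ℝ)
    (hv : ∃ C : ℝ≥0, LipschitzOnWith C v (Metric.ball x₀ (3 * r)))
    (hw : ∃ C : ℝ≥0, LipschitzOnWith C w (Metric.ball x₀ (3 * r)))
    (hsub : ∀ φ : Eucl n → ℝ, ContDiff ℝ (⊤ : ℕ∞) φ → HasCompactSupport φ →
      tsupport φ ⊆ Metric.ball x₀ (3 * r) → (∀ x, 0 ≤ φ x) →
      (∫ x in Metric.ball x₀ (3 * r),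
        (⟪F x (v x) (gradient v x), gradient φ x⟫_ℝ +
          F₀ x (v x) (gradient v x) * φ x)) ≤ 0)
    (hsup : ∀ φ : Eucl n → ℝ, ContDiff ℝ (⊤ : ℕ∞) φ → HasCompactSupport φ →
      tsupport φ ⊆ Metric.ball x₀ (3 * r) → (∀ x, 0 ≤ φ x) →
      0 ≤ ∫ x in Metric.ball x₀ (3 * r),
        (⟪F x (w x) (gradient w x), gradient φ x⟫_ℝ +
          F₀ x (w x) (gradient w x) * φ x))
    (hle : ∀ x ∈ Metric.ball x₀ (3 * r), v x ≤ w x)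
    (heq : v x₀ = w x₀) :
    ∀ x ∈ Metric.ball x₀ r, v x = w x := by
  have hxs : x₀ ∈ Metric.ball x₀ (3 * r) := mem_ball_self (by linarith)
  set s : Set (Eucl n) := Metric.ball x₀ (3 * r) with hs
  have hso : IsOpen s := isOpen_ball
  obtain ⟨Lv, hvL⟩ := hv
  obtain ⟨Lw, hwL⟩ := hw
  obtain ⟨v', hv', hvv'⟩ := hvL.extend_real
  obtain ⟨w', hw', hww'⟩ := hwL.extend_real
  have hgrad : ∀ {a a' : Eucl n → ℝ}, Set.EqOn a a' s → ∀ x ∈ s, gradient a x = gradient a' x :=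
    fun h x hx => (Filter.eventuallyEq_of_mem (hso.mem_nhds hx) h).gradient_eq
  have hint : ∀ {a a' : Eucl n → ℝ}, Set.EqOn a a' s → ∀ φ : Eucl n → ℝ,
      ∫ x in s, (⟪F x (a x) (gradient a x), gradient φ x⟫_ℝ +
        F₀ x (a x) (gradient a x) * φ x) =
      ∫ x in s, (⟪F x (a' x) (gradient a' x), gradient φ x⟫_ℝ +
        F₀ x (a' x) (gradient a' x) * φ x) := fun h φ =>
    setIntegral_congr_fun hso.measurableSet fun x hx => by
      simp only [hgrad h x hx, h hx]
  have hev : ∀ x ∈ s, v' x = w' x → ∀ᶠ y in 𝓝 x, v' y = w' y := fun x hx hxe =>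
    eventually_eq_of_sub_of_super volume hso hF hF₀ hell hv' hw'
      (fun φ h1 h2 h3 h4 => (hint hvv' φ).symm.trans_le (hsub φ h1 h2 h3 h4))
      (fun φ h1 h2 h3 h4 => (hsup φ h1 h2 h3 h4).trans_eq (hint hww' φ))
      (fun y hy => (hvv' hy).symm.trans_le ((hle y hy).trans_eq (hww' hy))) hx hxe
  have hsubset : s ⊆ s ∩ {x | v' x = w' x} := by
    refine (convex_ball x₀ (3 * r)).isPreconnected.subset_of_closure_inter_subset
      (isOpen_iff_mem_nhds.2 fun x hx => ?_) ⟨x₀, hxs, hxs, ?_⟩ fun x hx => ⟨hx.2, ?_⟩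
    · exact Filter.inter_mem (hso.mem_nhds hx.1) (hev x hx.1 hx.2)
    · exact (hvv' hxs).symm.trans (heq.trans (hww' hxs))
    · exact closure_minimal Set.inter_subset_right
        (isClosed_eq hv'.continuous hw'.continuous) hx.1
  intro x hx
  have hxs' : x ∈ s := ball_subset_ball (by linarith) hx
  exact (hvv' hxs').trans ((hsubset hxs').2.trans (hww' hxs').symm)
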